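/- arXiv:2108.09349 — 9 statements merged into one kernel-verified Lean document; each statement's English description precedes it below -/
import Mathlib

section
/- For every integer p ≥ 3, the set A of positive angle structures for the edge-equation system of τ_p is nonempty, and the volume functional 𝒱 attains its maximum over the closure of A at a point of A itself; that is, there exists a (necessarily unique) α ∈ A with every entry in the open interval (0,π) such that 𝒱(β) ≤ 𝒱(α) for every β in the closure of A. -/
open Real

/-- The Lobachevsky function `Λ(x) = -∫₀ˣ log |2 sin t| dt`. -/
noncomputable def lob (x : ℝ) : ℝ := -∫ t in (0:ℝ)..x, Real.log |2 * Real.sin t|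

/-- A positive angle structure for the edge-equation system of the triangulation `τ_p`:
real triples `(R' i, B' i, D' i)` for `i = 0,…,p-1`, `(R i, B i, D i)` for `i = 1,…,p`,
and `(Rs, Bs, Ds)`, with all entries in `(0,π)`, each triple summing to `π`, and the
edge equations (E1)–(E7) satisfied. -/
def IsPosAngleStructure (p : ℕ) (R' B' D' R B D : ℕ → ℝ) (Rs Bs Ds : ℝ) : Prop :=
  (∀ i < p, R' i ∈ Set.Ioo 0 π ∧ B' i ∈ Set.Ioo 0 π ∧ D' i ∈ Set.Ioo 0 π) ∧
  (∀ i, 1 ≤ i → i ≤ p → R i ∈ Set.Ioo 0 π ∧ B i ∈ Set.Ioo 0 π ∧ D i ∈ Set.Ioo 0 π) ∧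
  (Rs ∈ Set.Ioo 0 π ∧ Bs ∈ Set.Ioo 0 π ∧ Ds ∈ Set.Ioo 0 π) ∧
  (∀ i < p, R' i + B' i + D' i = π) ∧
  (∀ i, 1 ≤ i → i ≤ p → R i + B i + D i = π) ∧
  (Rs + Bs + Ds = π) ∧
  -- (E1)
  (2 * ∑ i ∈ Finset.range p, R' i + 2 * ∑ i ∈ Finset.Icc 1 p, R i
      + 2 * Rs + D' 0 + D p = 2 * π) ∧
  -- (E2)
  (B' 0 + D 1 + Bs + D' (p - 1) + B p = 2 * π) ∧
  -- (E3)
  (B' 0 + D' 1 + Bs + D (p - 1) + B p = 2 * π) ∧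
  -- (E4)
  (∀ i, 2 ≤ i → i ≤ p - 2 → D (i - 1) + B i + B' i + D' (i + 1) = 2 * π) ∧
  -- (E5)
  (∀ i, 1 ≤ i → i ≤ p - 1 → D' (i - 1) + B i + B' i + D (i + 1) = 2 * π) ∧
  -- (E6)
  (Ds + B' 1 + B 1 + D' 2 = 2 * π) ∧
  -- (E7)
  (Ds + B' (p - 1) + B (p - 1) + D (p - 2) = 2 * π)

/-- The ambient space of angle assignments: six families of angles (for the primed
and unprimed tetrahedra) together with the triple of angles for the tetrahedron `s`. -/
abbrev AngleSpace : Type :=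
  (ℕ → ℝ) × (ℕ → ℝ) × (ℕ → ℝ) × (ℕ → ℝ) × (ℕ → ℝ) × (ℕ → ℝ) × ℝ × ℝ × ℝ

/-- The set of positive angle structures for `τ_p`, inside the ambient space. -/
def posAngleStructures (p : ℕ) : Set AngleSpace :=
  {θ | IsPosAngleStructure p θ.1 θ.2.1 θ.2.2.1 θ.2.2.2.1 θ.2.2.2.2.1 θ.2.2.2.2.2.1
        θ.2.2.2.2.2.2.1 θ.2.2.2.2.2.2.2.1 θ.2.2.2.2.2.2.2.2}

/-- The volume functional: the sum of `Λ` over the `3(2p+1)` entries of the family. -/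
noncomputable def volFun (p : ℕ) (θ : AngleSpace) : ℝ :=
  (∑ i ∈ Finset.range p, (lob (θ.1 i) + lob (θ.2.1 i) + lob (θ.2.2.1 i))) +
  (∑ i ∈ Finset.Icc 1 p, (lob (θ.2.2.2.1 i) + lob (θ.2.2.2.2.1 i) + lob (θ.2.2.2.2.2.1 i))) +
  lob θ.2.2.2.2.2.2.1 + lob θ.2.2.2.2.2.2.2.1 + lob θ.2.2.2.2.2.2.2.2

open Set Filter Topology

section Lobachevsky

theorem lob_zero : lob 0 = 0 := by simp [lob]

theorem intervalIntegrable_log_abs_two_mul_sin (a b : ℝ) :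
    IntervalIntegrable (fun t => Real.log |2 * Real.sin t|) MeasureTheory.volume a b := by
  have h : AnalyticOnNhd ℝ (fun t => 2 * Real.sin t) (uIcc a b) :=
    analyticOnNhd_const.mul (analyticOnNhd_sin.mono (subset_univ _))
  simp only [Real.log_abs]
  exact h.meromorphicOn.intervalIntegrable_log

theorem continuous_lob : Continuous lob :=
  (intervalIntegral.continuous_primitive intervalIntegrable_log_abs_two_mul_sin 0).neg

theorem hasDerivAt_lob {x : ℝ} (h0 : 0 < x) (h1 : x < π) :
    HasDerivAt lob (-Real.log (2 * Real.sin x)) x := by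
  have hs : 0 < Real.sin x := Real.sin_pos_of_pos_of_lt_pi h0 h1
  have hc : ContinuousAt (fun t => Real.log |2 * Real.sin t|) x := by
    have : |2 * Real.sin x| ≠ 0 := by positivity
    fun_prop (disch := assumption)
  have hm : Measurable (fun t => Real.log |2 * Real.sin t|) := by
    simp only [Real.log_abs]
    fun_prop
  have := (intervalIntegral.integral_hasDerivAt_right
    (intervalIntegrable_log_abs_two_mul_sin 0 x)
    hm.stronglyMeasurable.stronglyMeasurableAtFilter hc).neg
  rwa [Real.log_abs] at this

theorem lob_pi : lob π = 0 := by
  have h : ∫ t in (0:ℝ)..π, Real.log |2 * Real.sin t|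
      = ∫ t in (0:ℝ)..π, (Real.log 2 + Real.log (Real.sin t)) := by
    refine intervalIntegral.integral_congr_Ioo_of_le Real.pi_pos.le fun t ht => ?_
    have hs : 0 < Real.sin t := Real.sin_pos_of_pos_of_lt_pi ht.1 ht.2
    simp only [Real.log_abs]
    rw [Real.log_mul two_ne_zero hs.ne']
  have hi : IntervalIntegrable (fun t => Real.log (Real.sin t)) MeasureTheory.volume 0 π :=
    intervalIntegrable_log_sin
  rw [lob, h, intervalIntegral.integral_add (by simp) hi, integral_log_sin_zero_pi]
  simp
  ring

theorem lob_pi_sub (x : ℝ) : lob (π - x) = -lob x := by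
  have h := lob_pi
  have hsub := intervalIntegral.integral_comp_sub_left (a := x) (b := π)
    (fun t => Real.log |2 * Real.sin t|) π
  have hadd := intervalIntegral.integral_add_adjacent_intervals
    (intervalIntegrable_log_abs_two_mul_sin 0 x) (intervalIntegrable_log_abs_two_mul_sin x π)
  simp only [Real.sin_pi_sub, sub_self] at hsub
  unfold lob at h ⊢
  linarith

theorem lob_pos {x : ℝ} (h0 : 0 < x) (h1 : x < π / 2) : 0 < lob x := by
  have hpi := Real.pi_pos
  have hhalf : lob (π / 2) = 0 := by
    have := lob_pi_sub (π / 2)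
    rw [sub_half] at this
    linarith
  have hconc : StrictConcaveOn ℝ (Icc 0 (π / 2)) lob := by
    refine StrictAntiOn.strictConcaveOn_of_deriv (convex_Icc _ _) continuous_lob.continuousOn ?_
    rw [interior_Icc]
    intro a ha b hb hab
    rw [(hasDerivAt_lob ha.1 (by linarith [ha.2])).deriv,
      (hasDerivAt_lob hb.1 (by linarith [hb.2])).deriv, neg_lt_neg_iff]
    have hs : 0 < Real.sin a := Real.sin_pos_of_pos_of_lt_pi ha.1 (by linarith [ha.2])
    refine Real.log_lt_log (by positivity) ?_
    have := Real.sin_lt_sin_of_lt_of_le_pi_div_two (by linarith [ha.1]) hb.2.le hab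
    linarith
  have hs : 0 < 1 - x / (π / 2) := by
    rw [sub_pos, div_lt_one (by positivity)]
    exact h1
  have := hconc.2 (left_mem_Icc.2 (by positivity)) (right_mem_Icc.2 (by positivity))
    (by positivity) hs (show 0 < x / (π / 2) by positivity) (by ring)
  rw [lob_zero, hhalf] at this
  have e : x / (π / 2) * (π / 2) = x := by field_simp
  simpa [e] using this

theorem neg_mul_log_le_lob {y : ℝ} (h0 : 0 < y) (h1 : y < π) :
    -y * Real.log (2 * y) ≤ lob y := by
  obtain ⟨c, hc, hc'⟩ := exists_hasDerivAt_eq_slope lob (fun x => -Real.log (2 * Real.sin x)) h0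
    continuous_lob.continuousOn
    (fun x hx => hasDerivAt_lob hx.1 (hx.2.trans h1))
  rw [lob_zero, sub_zero, sub_zero, eq_div_iff h0.ne'] at hc'
  have hs : 0 < Real.sin c := Real.sin_pos_of_pos_of_lt_pi hc.1 (hc.2.trans h1)
  have : Real.log (2 * Real.sin c) ≤ Real.log (2 * y) :=
    Real.log_le_log (by positivity) (by linarith [Real.sin_le hc.1.le, hc.2])
  nlinarith

end Lobachevsky

section Triangle

/-- The sum of the Lobachevsky function over the three angles of a triangle. -/
noncomputable def tri (x y z : ℝ) : ℝ := lob x + lob y + lob z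

theorem cot_quadratic_form_nonneg {x y z : ℝ} (hx : 0 < x) (hy : 0 < y) (hz : 0 < z)
    (h : x + y + z = π) {u v w : ℝ} (huvw : u + v + w = 0) :
    0 ≤ u ^ 2 * (cos x / sin x) + v ^ 2 * (cos y / sin y) + w ^ 2 * (cos z / sin z) := by
  have sx : 0 < sin x := sin_pos_of_pos_of_lt_pi hx (by linarith)
  have sy : 0 < sin y := sin_pos_of_pos_of_lt_pi hy (by linarith)
  have sz : 0 < sin z := sin_pos_of_pos_of_lt_pi hz (by linarith)
  have ez : z = π - (x + y) := by linarith
  have hsz : sin z = sin x * cos y + cos x * sin y := by rw [ez, sin_pi_sub, sin_add]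
  have hcz : cos z = sin x * sin y - cos x * cos y := by
    rw [ez, cos_pi_sub, cos_add]; ring
  have hw : w = -(u + v) := by linarith
  have hcot : cos x / sin x * (cos y / sin y) + cos y / sin y * (cos z / sin z)
      + cos z / sin z * (cos x / sin x) = 1 := by
    field_simp
    rw [hcz, hsz]
    ring
  have hpos : 0 < cos x / sin x + cos z / sin z := by
    have : cos x / sin x + cos z / sin z = sin y / (sin x * sin z) := by
      have hy' : sin y = sin x * cos z + cos x * sin z := by
        rw [show y = π - (x + z) by linarith, sin_pi_sub, sin_add]
      rw [hy']
      field_simp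
      ring
    rw [this]
    positivity
  set a := cos x / sin x
  set b := cos y / sin y
  set c := cos z / sin z
  have key : 0 ≤ (a + c) * (u ^ 2 * a + v ^ 2 * b + w ^ 2 * c) := by
    have : (a + c) * (u ^ 2 * a + v ^ 2 * b + w ^ 2 * c) = ((a + c) * u + c * v) ^ 2 + v ^ 2 := by
      rw [hw]
      linear_combination v ^ 2 * hcot
    rw [this]
    positivity
  exact nonneg_of_mul_nonneg_right key hpos

theorem concaveOn_tri_segment {x y z a b c : ℝ} (hx : 0 ≤ x) (hy : 0 ≤ y) (hz : 0 ≤ z)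
    (h : x + y + z = π) (ha : 0 < a) (hb : 0 < b) (hc : 0 < c) (h' : a + b + c = π) :
    ConcaveOn ℝ (Icc 0 1)
      (fun t => tri (x + t * (a - x)) (y + t * (b - y)) (z + t * (c - z))) := by
  have pos : ∀ {x a t : ℝ}, 0 ≤ x → 0 < a → t ∈ Ioo (0:ℝ) 1 → 0 < x + t * (a - x) := by
    intro x a t hx ha ht
    nlinarith [mul_pos ht.1 ha, mul_nonneg hx (sub_nonneg.2 ht.2.le)]
  have hsum : ∀ t : ℝ, x + t * (a - x) + (y + t * (b - y)) + (z + t * (c - z)) = π := by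
    intro t
    linear_combination (1 - t) * h + t * h'
  have hlin : ∀ x a t : ℝ, HasDerivAt (fun t => x + t * (a - x)) (a - x) t := by
    intro x a t
    simpa using ((hasDerivAt_id t).mul_const (a - x)).const_add x
  have d1 : ∀ {x a t : ℝ}, 0 < x + t * (a - x) → x + t * (a - x) < π →
      HasDerivAt (fun t => lob (x + t * (a - x)))
        (-Real.log (2 * sin (x + t * (a - x))) * (a - x)) t := by
    intro x a t h0 h1
    exact HasDerivAt.comp (h₂ := lob) t (hasDerivAt_lob h0 h1) (hlin x a t)
  have d2 : ∀ {x a t : ℝ}, 0 < x + t * (a - x) → x + t * (a - x) < π →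
      HasDerivAt (fun t => -Real.log (2 * sin (x + t * (a - x))) * (a - x))
        (-((a - x) ^ 2 * (cos (x + t * (a - x)) / sin (x + t * (a - x))))) t := by
    intro x a t h0 h1
    have hs := sin_pos_of_pos_of_lt_pi h0 h1
    refine HasDerivAt.congr_deriv
      ((((hlin x a t).sin.const_mul 2).log (by positivity)).neg.mul_const (a - x)) ?_
    field_simp
  refine concaveOn_of_hasDerivWithinAt2_nonpos (convex_Icc 0 1)
    (f' := fun t => -Real.log (2 * sin (x + t * (a - x))) * (a - x)
      + -Real.log (2 * sin (y + t * (b - y))) * (b - y)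
      + -Real.log (2 * sin (z + t * (c - z))) * (c - z))
    (f'' := fun t => -((a - x) ^ 2 * (cos (x + t * (a - x)) / sin (x + t * (a - x))))
      + -((b - y) ^ 2 * (cos (y + t * (b - y)) / sin (y + t * (b - y))))
      + -((c - z) ^ 2 * (cos (z + t * (c - z)) / sin (z + t * (c - z))))) ?_ ?_ ?_ ?_
  · have := continuous_lob
    unfold tri
    exact Continuous.continuousOn (by fun_prop)
  all_goals
    rw [interior_Icc]
    intro t ht
    have px := pos hx ha ht
    have py := pos hy hb ht
    have pz := pos hz hc ht
    have hs := hsum t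
  · exact (((d1 px (by linarith)).add (d1 py (by linarith))).add
      (d1 pz (by linarith))).hasDerivWithinAt
  · exact (((d2 px (by linarith)).add (d2 py (by linarith))).add
      (d2 pz (by linarith))).hasDerivWithinAt
  · have := cot_quadratic_form_nonneg px py pz hs
      (u := a - x) (v := b - y) (w := c - z) (by linarith)
    linarith

theorem tri_segment_ge {x y z a b c : ℝ} (hx : 0 ≤ x) (hy : 0 ≤ y) (hz : 0 ≤ z)
    (h : x + y + z = π) (ha : 0 < a) (hb : 0 < b) (hc : 0 < c) (h' : a + b + c = π)
    {t : ℝ} (h0 : 0 ≤ t) (h1 : t ≤ 1) :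
    tri x y z + t * (tri a b c - tri x y z)
      ≤ tri (x + t * (a - x)) (y + t * (b - y)) (z + t * (c - z)) := by
  have := (concaveOn_tri_segment hx hy hz h ha hb hc h').2 (x := 0) (y := 1)
    ⟨le_rfl, zero_le_one⟩ ⟨zero_le_one, le_rfl⟩ (sub_nonneg.2 h1) h0 (by ring)
  simp only [smul_eq_mul, mul_zero, mul_one, zero_add, zero_mul, add_zero, one_mul,
    add_sub_cancel] at this
  linarith

theorem tendsto_tri_slope_atTop_of_left_eq_zero {y z a b c : ℝ} (hy : 0 < y) (hz : 0 < z)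
    (h : y + z = π) (ha : 0 < a) :
    Tendsto (fun t => t⁻¹ * (tri (0 + t * (a - 0)) (y + t * (b - y)) (z + t * (c - z))
      - tri 0 y z)) (𝓝[>] 0) atTop := by
  have hfin : ∀ {y b : ℝ}, 0 < y → y < π → Tendsto
      (fun t => t⁻¹ * (lob (y + t * (b - y)) - lob y)) (𝓝[>] 0)
        (𝓝 (-Real.log (2 * sin y) * (b - y))) := by
    intro y b h0 h1
    have hlin : HasDerivAt (fun t => y + t * (b - y)) (b - y) 0 := by
      simpa using ((hasDerivAt_id (0:ℝ)).mul_const (b - y)).const_add y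
    have hd : HasDerivAt (fun t => lob (y + t * (b - y))) (-Real.log (2 * sin y) * (b - y)) 0 := by
      refine HasDerivAt.comp (0:ℝ) (h₂ := lob) ?_ hlin
      simpa using hasDerivAt_lob h0 h1
    simpa using hd.tendsto_slope_zero.mono_left (nhdsGT_le_nhdsNE 0)
  have hinf : Tendsto (fun t => t⁻¹ * lob (t * a)) (𝓝[>] 0) atTop := by
    have hlog : Tendsto (fun t => -a * Real.log (2 * (t * a))) (𝓝[>] 0) atTop := by
      refine Tendsto.const_mul_atBot_of_neg (by linarith) ?_
      refine Real.tendsto_log_nhdsGT_zero.comp ?_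
      refine tendsto_nhdsWithin_iff.2 ⟨?_, ?_⟩
      · have : Continuous fun t : ℝ => 2 * (t * a) := by fun_prop
        simpa using (this.tendsto 0).mono_left nhdsWithin_le_nhds
      · filter_upwards [self_mem_nhdsWithin] with t ht
        have : (0:ℝ) < t := ht
        exact mem_Ioi.2 (by positivity)
    refine tendsto_atTop_mono' _ ?_ hlog
    have hlt : ∀ᶠ t in 𝓝[>] (0:ℝ), t < π / a :=
      mem_nhdsWithin_of_mem_nhds (Iio_mem_nhds (by positivity))
    filter_upwards [self_mem_nhdsWithin, hlt] with t ht ht'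
    have ht0 : (0:ℝ) < t := ht
    have := neg_mul_log_le_lob (y := t * a) (by positivity) ((lt_div_iff₀ ha).1 ht')
    rw [inv_mul_eq_div, le_div_iff₀ ht0]
    linarith
  refine ((hinf.atTop_add (hfin (b := b) hy (by linarith))).atTop_add
    (hfin (b := c) hz (by linarith))).congr fun t => ?_
  simp only [tri, lob_zero, zero_add, sub_zero]
  ring

theorem tendsto_tri_slope_atTop {x y z a b c : ℝ} (hx : 0 ≤ x) (hy : 0 ≤ y) (hz : 0 ≤ z)
    (h : x + y + z = π) (ha : 0 < a) (hb : 0 < b) (hc : 0 < c)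
    (hbad : (x = 0 ∧ y ≠ 0 ∧ z ≠ 0) ∨ (y = 0 ∧ x ≠ 0 ∧ z ≠ 0) ∨ (z = 0 ∧ x ≠ 0 ∧ y ≠ 0)) :
    Tendsto (fun t => t⁻¹ * (tri (x + t * (a - x)) (y + t * (b - y)) (z + t * (c - z))
      - tri x y z)) (𝓝[>] 0) atTop := by
  rcases hbad with ⟨rfl, h1, h2⟩ | ⟨rfl, h1, h2⟩ | ⟨rfl, h1, h2⟩
  · exact tendsto_tri_slope_atTop_of_left_eq_zero (by positivity) (by positivity)
      (by linarith) ha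
  · refine (tendsto_tri_slope_atTop_of_left_eq_zero (b := a) (c := c)
      (y := x) (z := z) (by positivity) (by positivity) (by linarith) hb).congr fun t => ?_
    simp only [tri]
    ring
  · refine (tendsto_tri_slope_atTop_of_left_eq_zero (b := a) (c := b)
      (y := x) (z := y) (by positivity) (by positivity) (by linarith) hc).congr fun t => ?_
    simp only [tri]
    ring

end Triangle

section ReducedProblem

/-- The angles `R` determined by the sequence `d` of angles `D` in a symmetric structure. -/
noncomputable def angleR (d : ℕ → ℝ) : ℕ → ℝ
  | 0 => (π - 3 * d 0 + 2 * d 1) / 3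
  | i + 1 => (d i + d (i + 2)) / 2 - d (i + 1)

/-- The angles `B` determined by the sequence `d` of angles `D` in a symmetric structure. -/
noncomputable def angleB (d : ℕ → ℝ) (i : ℕ) : ℝ := π - d i - angleR d i

/-- The multiplicity of the tetrahedra with index `i` in a symmetric structure. -/
def tetMult : ℕ → ℝ
  | 0 => 3
  | _ + 1 => 2

/-- The volume of the symmetric structure determined by `d`. -/
noncomputable def symVol (p : ℕ) (d : ℕ → ℝ) : ℝ :=
  ∑ i ∈ Finset.range p, tetMult i * tri (angleR d i) (angleB d i) (d i)

/-- The sequences of angles `D` of the nonnegative symmetric structures. -/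
def symSeqs (p : ℕ) : Set (ℕ → ℝ) :=
  {d | (∀ i, d i ∈ Icc 0 π) ∧ (∀ i ≤ p, d (p - i) = d i) ∧
    ∀ i < p, 0 ≤ angleR d i ∧ 0 ≤ angleB d i}

/-- The sequences of angles `D` of the positive symmetric structures. -/
def posSymSeqs (p : ℕ) : Set (ℕ → ℝ) :=
  {d | (∀ i, d i ∈ Icc 0 π) ∧ (∀ i ≤ p, d (p - i) = d i) ∧
    ∀ i < p, 0 < angleR d i ∧ 0 < angleB d i ∧ 0 < d i}

theorem posSymSeqs_subset (p : ℕ) : posSymSeqs p ⊆ symSeqs p :=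
  fun _ h => ⟨h.1, h.2.1, fun i hi => ⟨(h.2.2 i hi).1.le, (h.2.2 i hi).2.1.le⟩⟩

theorem tetMult_pos (i : ℕ) : 0 < tetMult i := by
  cases i <;> simp [tetMult]

theorem angle_sum (d : ℕ → ℝ) (i : ℕ) : angleR d i + angleB d i + d i = π := by
  unfold angleB; ring

theorem angleB_zero (d : ℕ → ℝ) : angleB d 0 = 2 * (π - d 1) / 3 := by
  simp only [angleB, angleR]; ring

theorem angleB_succ (d : ℕ → ℝ) (i : ℕ) : angleB d (i + 1) = π - (d i + d (i + 2)) / 2 := by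
  simp only [angleB, angleR]; ring

theorem angleR_segment (d e : ℕ → ℝ) (t : ℝ) (i : ℕ) :
    angleR (fun j => d j + t * (e j - d j)) i
      = angleR d i + t * (angleR e i - angleR d i) := by
  cases i <;> simp only [angleR] <;> ring

theorem angleB_segment (d e : ℕ → ℝ) (t : ℝ) (i : ℕ) :
    angleB (fun j => d j + t * (e j - d j)) i
      = angleB d i + t * (angleB e i - angleB d i) := by
  simp only [angleB, angleR_segment]; ring

theorem continuous_angleR (i : ℕ) : Continuous fun d : ℕ → ℝ => angleR d i := by
  cases i <;> simp only [angleR] <;> fun_prop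

theorem continuous_angleB (i : ℕ) : Continuous fun d : ℕ → ℝ => angleB d i := by
  have := continuous_angleR i
  unfold angleB
  fun_prop

theorem continuous_symVol (p : ℕ) : Continuous (symVol p) := by
  have h1 := continuous_angleR
  have h2 := continuous_angleB
  have h3 := continuous_lob
  unfold symVol tri
  fun_prop

theorem isCompact_symSeqs (p : ℕ) : IsCompact (symSeqs p) := by
  have hK : IsCompact (Set.pi univ fun _ : ℕ => Icc (0:ℝ) π) :=
    isCompact_univ_pi fun _ => isCompact_Icc
  have hC : IsClosed {d : ℕ → ℝ | (∀ i ≤ p, d (p - i) = d i) ∧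
      ∀ i < p, 0 ≤ angleR d i ∧ 0 ≤ angleB d i} := by
    simp only [ofPred_and, ofPred_forall]
    refine IsClosed.inter ?_ ?_
    · exact isClosed_iInter fun i => isClosed_iInter fun _ =>
        isClosed_eq (by fun_prop) (by fun_prop)
    · exact isClosed_iInter fun i => isClosed_iInter fun _ =>
        (isClosed_le continuous_const (continuous_angleR i)).inter
          (isClosed_le continuous_const (continuous_angleB i))
  convert hK.inter_right hC using 1
  ext d
  simp only [symSeqs, mem_inter_iff, mem_univ_pi, mem_ofPred_eq]

theorem posSymSeqs_nonempty {p : ℕ} (hp : 3 ≤ p) : (posSymSeqs p).Nonempty := by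
  have hpi := Real.pi_pos
  have hp' : (3:ℝ) ≤ p := by exact_mod_cast hp
  set c : ℝ := π / (4 * (1 + (p:ℝ) ^ 2)) with hc
  have hc0 : 0 < c := by positivity
  have hc1 : c * (1 + (p:ℝ) ^ 2) = π / 4 := by
    rw [hc]; field_simp
  have hbound : ∀ i : ℕ, i ≤ p → c * (1 + (2 * (i:ℝ) - p) ^ 2) ≤ π / 4 := by
    intro i hi
    have hi' : (i:ℝ) ≤ p := by exact_mod_cast hi
    have hi0 : (0:ℝ) ≤ i := Nat.cast_nonneg i
    rw [← hc1]
    refine mul_le_mul_of_nonneg_left ?_ hc0.le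
    nlinarith
  have hpos : ∀ i : ℕ, 0 < c * (1 + (2 * (i:ℝ) - p) ^ 2) := fun i => by positivity
  refine ⟨fun i => if i ≤ p then c * (1 + (2 * (i:ℝ) - p) ^ 2) else 0, ?_, ?_, ?_⟩
  · intro i
    dsimp only
    split_ifs with hi
    · exact ⟨(hpos i).le, by linarith [hbound i hi]⟩
    · exact ⟨le_rfl, hpi.le⟩
  · intro i hi
    simp only [hi, Nat.sub_le, if_true, Nat.cast_sub hi]
    ring
  · intro i hi
    refine ⟨?_, ?_, ?_⟩
    · cases i with
      | zero =>
        have h0 := hbound 0 (by omega)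
        have h1 := hpos 1
        simp only [angleR, Nat.zero_le, if_true, if_pos (show 1 ≤ p by omega)]
        push_cast at h0 h1 ⊢
        linarith
      | succ i =>
        simp only [angleR, if_pos (show i ≤ p by omega), if_pos (show i + 1 ≤ p by omega),
          if_pos (show i + 2 ≤ p by omega)]
        push_cast
        nlinarith
    · cases i with
      | zero =>
        have h1 := hbound 1 (by omega)
        simp only [angleB_zero, if_pos (show 1 ≤ p by omega)]
        linarith
      | succ i =>
        have h1 := hbound i (by omega)
        have h2 := hbound (i + 2) (by omega)
        simp only [angleB_succ, if_pos (show i ≤ p by omega), if_pos (show i + 2 ≤ p by omega)]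
        linarith
    · simpa only [if_pos hi.le] using hpos i

theorem segment_mem_symSeqs {p : ℕ} {d e : ℕ → ℝ} (hd : d ∈ symSeqs p) (he : e ∈ symSeqs p)
    {t : ℝ} (h0 : 0 ≤ t) (h1 : t ≤ 1) : (fun j => d j + t * (e j - d j)) ∈ symSeqs p := by
  have key : ∀ {x a : ℝ}, 0 ≤ x → 0 ≤ a → 0 ≤ x + t * (a - x) := by
    intro x a hx ha
    nlinarith [mul_nonneg h0 ha, mul_nonneg hx (sub_nonneg.2 h1)]
  refine ⟨fun i => ⟨key (hd.1 i).1 (he.1 i).1, ?_⟩, fun i hi => ?_, fun i hi => ⟨?_, ?_⟩⟩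
  · have := key (sub_nonneg.2 (hd.1 i).2) (sub_nonneg.2 (he.1 i).2)
    dsimp only
    linarith
  · simp only [hd.2.1 i hi, he.2.1 i hi]
  · rw [angleR_segment]
    exact key (hd.2.2 i hi).1 (he.2.2 i hi).1
  · rw [angleB_segment]
    exact key (hd.2.2 i hi).2 (he.2.2 i hi).2

/-- At a maximum of the volume a triangle with a zero angle has two zero angles. -/
theorem not_degenerate_of_isMaxOn {p : ℕ} {d e : ℕ → ℝ} (hd : d ∈ symSeqs p)
    (hmax : IsMaxOn (symVol p) (symSeqs p) d) (he : e ∈ posSymSeqs p) {i : ℕ} (hi : i < p) :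
    ¬ ((angleR d i = 0 ∧ angleB d i ≠ 0 ∧ d i ≠ 0) ∨
      (angleB d i = 0 ∧ angleR d i ≠ 0 ∧ d i ≠ 0) ∨
      (d i = 0 ∧ angleR d i ≠ 0 ∧ angleB d i ≠ 0)) := by
  intro hbad
  set f : ℕ → ℝ → ℝ := fun j t => tri (angleR d j + t * (angleR e j - angleR d j))
    (angleB d j + t * (angleB e j - angleB d j)) (d j + t * (e j - d j)) with hf
  set g : ℕ → ℝ := fun j => tri (angleR d j) (angleB d j) (d j) with hg
  set C : ℕ → ℝ := fun j => tri (angleR e j) (angleB e j) (e j) - g j with hC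
  have hlim : Tendsto (fun t => t⁻¹ * (f i t - g i)) (𝓝[>] 0) atTop := by
    obtain ⟨h1, h2, h3⟩ := he.2.2 i hi
    exact tendsto_tri_slope_atTop (hd.2.2 i hi).1 (hd.2.2 i hi).2 (hd.1 i).1 (angle_sum d i)
      h1 h2 h3 hbad
  have hlow : ∀ j < p, ∀ t ∈ Ioo (0:ℝ) 1, t * C j ≤ f j t - g j := by
    intro j hj t ht
    obtain ⟨h1, h2, h3⟩ := he.2.2 j hj
    have := tri_segment_ge (hd.2.2 j hj).1 (hd.2.2 j hj).2 (hd.1 j).1 (angle_sum d j)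
      h1 h2 h3 (angle_sum e j) ht.1.le ht.2.le
    simp only [hf, hg, hC]
    linarith
  have hle : ∀ t ∈ Ioo (0:ℝ) 1, ∑ j ∈ Finset.range p, tetMult j * (f j t - g j) ≤ 0 := by
    intro t ht
    have := hmax (segment_mem_symSeqs hd (posSymSeqs_subset p he) ht.1.le ht.2.le)
    simp only [symVol, mem_ofPred_eq, angleR_segment, angleB_segment] at this
    simp only [mul_sub, Finset.sum_sub_distrib]
    linarith
  have himem : i ∈ Finset.range p := Finset.mem_range.2 hi
  set S : ℝ := ∑ j ∈ (Finset.range p).erase i, tetMult j * C j with hS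
  have hbig : ∀ᶠ t in 𝓝[>] (0:ℝ), -S / tetMult i < t⁻¹ * (f i t - g i) :=
    hlim.eventually_gt_atTop _
  have hsmall : ∀ᶠ t in 𝓝[>] (0:ℝ), t ∈ Ioo (0:ℝ) 1 := Ioo_mem_nhdsGT one_pos
  obtain ⟨t, ht1, ht2⟩ := (hbig.and hsmall).exists
  have hsum := hle t ht2
  rw [← Finset.add_sum_erase _ _ himem] at hsum
  have hrest : t * S ≤ ∑ j ∈ (Finset.range p).erase i, tetMult j * (f j t - g j) := by
    rw [hS, Finset.mul_sum]
    refine Finset.sum_le_sum fun j hj => ?_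
    have := mul_le_mul_of_nonneg_left
      (hlow j (Finset.mem_range.1 (Finset.mem_of_mem_erase hj)) t ht2) (tetMult_pos j).le
    linarith
  rw [div_lt_iff₀ (tetMult_pos i), inv_mul_eq_div, div_mul_eq_mul_div,
    lt_div_iff₀ ht2.1] at ht1
  linarith

theorem eq_pi_of_exists_eq_pi {p : ℕ} (hp : 2 ≤ p) {d : ℕ → ℝ} (hd : d ∈ symSeqs p) {i : ℕ}
    (hi : i < p) (h : d i = π) : ∀ j ≤ p, d j = π := by
  have hstep : ∀ k, k + 1 < p → d (k + 1) = π → d k = π ∧ d (k + 2) = π := by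
    intro k hk hk'
    have h1 := (hd.2.2 (k + 1) hk).1
    have h2 := (hd.1 k).2
    have h3 := (hd.1 (k + 2)).2
    simp only [angleR] at h1
    constructor <;> linarith
  have hdown : ∀ k, k < p → d k = π → d 0 = π := by
    intro k
    induction k with
    | zero => exact fun _ h => h
    | succ k ih => exact fun hk h => ih (by omega) (hstep k hk h).1
  have h0 := hdown i hi h
  have h1 : d 1 = π := by
    have h2 := (hd.2.2 0 (by omega)).1
    have h3 := (hd.1 1).2
    simp only [angleR] at h2
    linarith
  have hup : ∀ k, k + 1 ≤ p → d k = π ∧ d (k + 1) = π := by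
    intro k
    induction k with
    | zero => exact fun _ => ⟨h0, h1⟩
    | succ k ih =>
      intro hk
      have := (ih (by omega)).2
      exact ⟨this, (hstep k (by omega) this).2⟩
  intro j hj
  cases j with
  | zero => exact h0
  | succ j => exact (hup j hj).2

theorem symVol_eq_zero_of_eq_pi {p : ℕ} {d : ℕ → ℝ} (h : ∀ j ≤ p, d j = π) :
    symVol p d = 0 := by
  refine Finset.sum_eq_zero fun i hi => ?_
  have hi' := Finset.mem_range.1 hi
  have hR : angleR d i = 0 := by
    cases i with
    | zero => simp only [angleR, h 0 (by omega), h 1 (by omega)]; ring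
    | succ i =>
      simp only [angleR, h i (by omega), h (i + 1) (by omega), h (i + 2) (by omega)]; ring
  simp [angleB, hR, h i hi'.le, tri, lob_zero, lob_pi]

theorem exists_symVol_pos {p : ℕ} (hp : 1 ≤ p) : ∃ d ∈ symSeqs p, 0 < symVol p d := by
  have hpi := Real.pi_pos
  refine ⟨fun _ => π / 3, ⟨fun i => ⟨by positivity, by linarith⟩, fun _ _ => rfl, ?_⟩, ?_⟩
  · intro i _
    cases i with
    | zero => simp only [angleR, angleB_zero]; constructor <;> linarith
    | succ i => simp only [angleR, angleB_succ]; constructor <;> linarith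
  · obtain ⟨n, rfl⟩ : ∃ n, p = n + 1 := ⟨p - 1, by omega⟩
    rw [symVol, Finset.sum_range_succ']
    have hzero : ∀ i, tri (angleR (fun _ => π / 3) (i + 1)) (angleB (fun _ => π / 3) (i + 1))
        (π / 3) = 0 := by
      intro i
      have h1 : (π / 3 + π / 3) / 2 - π / 3 = 0 := by ring
      have h2 : π - (π / 3 + π / 3) / 2 = π - π / 3 := by ring
      simp only [angleB_succ, angleR, tri, h1, h2, lob_zero, lob_pi_sub]
      ring
    simp only [hzero, mul_zero, Finset.sum_const_zero, zero_add]
    refine mul_pos (tetMult_pos 0) ?_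
    simp only [angleB_zero, angleR, tri]
    have h1 := lob_pos (x := (π - 3 * (π / 3) + 2 * (π / 3)) / 3) (by linarith) (by linarith)
    have h2 := lob_pos (x := 2 * (π - π / 3) / 3) (by linarith) (by linarith)
    have h3 := lob_pos (x := π / 3) (by linarith) (by linarith)
    linarith

theorem mem_posSymSeqs_of_isMaxOn {p : ℕ} (hp : 3 ≤ p) {d : ℕ → ℝ} (hd : d ∈ symSeqs p)
    (hmax : IsMaxOn (symVol p) (symSeqs p) d) : d ∈ posSymSeqs p := by
  obtain ⟨e, he⟩ := posSymSeqs_nonempty hp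
  have hpi := Real.pi_pos
  have hnd := fun {i : ℕ} (hi : i < p) => not_degenerate_of_isMaxOn hd hmax he hi
  have hne : ∀ i < p, d i ≠ π := by
    intro i hi h
    obtain ⟨d', hd', hpos⟩ := exists_symVol_pos (p := p) (by omega)
    have h1 : symVol p d' ≤ symVol p d := hmax hd'
    rw [symVol_eq_zero_of_eq_pi (eq_pi_of_exists_eq_pi (by omega) hd hi h)] at h1
    linarith
  have hB : ∀ i < p, angleB d i ≠ 0 := by
    intro i hi h
    cases i with
    | zero =>
      rw [angleB_zero] at h
      exact hne 1 (by omega) (by linarith)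
    | succ i =>
      rw [angleB_succ] at h
      exact hne i (by omega) (by linarith [(hd.1 i).2, (hd.1 (i + 2)).2])
  have h0 : d 0 ≠ 0 := by
    intro h
    have hR : angleR d 0 ≠ 0 := by
      have := (hd.1 1).1
      simp only [angleR, h]
      exact ne_of_gt (by linarith)
    exact hnd (i := 0) (by omega) (Or.inr (Or.inr ⟨h, hR, hB 0 (by omega)⟩))
  have hD : ∀ i < p, d i ≠ 0 := by
    intro i
    induction i with
    | zero => exact fun _ => h0
    | succ i ih =>
      intro hi h
      have hR : angleR d (i + 1) = 0 := by
        by_contra hR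
        exact hnd hi (Or.inr (Or.inr ⟨h, hR, hB _ hi⟩))
      simp only [angleR] at hR
      exact ih (by omega) (by linarith [(hd.1 i).1, (hd.1 (i + 2)).1])
  refine ⟨hd.1, hd.2.1, fun i hi => ?_⟩
  have hR : angleR d i ≠ 0 := fun hR => hnd hi (Or.inl ⟨hR, hB i hi, hD i hi⟩)
  exact ⟨(hd.2.2 i hi).1.lt_of_ne' hR, (hd.2.2 i hi).2.lt_of_ne' (hB i hi),
    (hd.1 i).1.lt_of_ne' (hD i hi)⟩

end ReducedProblem

section Symmetric

theorem sum_Icc_one_reflect (p : ℕ) (f : ℕ → ℝ) :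
    ∑ i ∈ Finset.Icc 1 p, f (p - i) = ∑ i ∈ Finset.range p, f i := by
  refine Finset.sum_nbij' (fun i => p - i) (fun i => p - i) ?_ ?_ ?_ ?_ (fun _ _ => rfl) <;>
    simp only [Finset.mem_Icc, Finset.mem_range] <;> omega

/-- The symmetric angle assignment determined by the sequence `d` of angles `D`. -/
noncomputable def symStructure (p : ℕ) (d : ℕ → ℝ) : AngleSpace :=
  (angleR d, angleB d, d, fun i => angleR d (p - i), fun i => angleB d (p - i),
    fun i => d (p - i), angleR d 0, angleB d 0, d 0)

theorem angleB_reflect {p : ℕ} {d : ℕ → ℝ} (hd : ∀ i ≤ p, d (p - i) = d i) {i : ℕ}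
    (h1 : 1 ≤ i) (h2 : i < p) : angleB d (p - i) = angleB d i := by
  obtain ⟨k, rfl⟩ : ∃ k, i = k + 1 := ⟨i - 1, by omega⟩
  have h3 := hd k (by omega)
  have h4 := hd (k + 2) (by omega)
  rw [show p - (k + 1) = (p - (k + 2)) + 1 by omega, angleB_succ, angleB_succ, h4,
    show p - (k + 2) + 2 = p - k by omega, h3]
  ring

theorem angleB_eq {d : ℕ → ℝ} {i : ℕ} (h1 : 1 ≤ i) :
    angleB d i = π - (d (i - 1) + d (i + 1)) / 2 := by
  obtain ⟨k, rfl⟩ : ∃ k, i = k + 1 := ⟨i - 1, by omega⟩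
  exact angleB_succ d k

theorem sum_angleR (d : ℕ → ℝ) (n : ℕ) :
    ∑ i ∈ Finset.range (n + 1), angleR d i
      = angleR d 0 + (d (n + 1) - d n - d 1 + d 0) / 2 := by
  induction n with
  | zero => simp
  | succ n ih =>
    rw [Finset.sum_range_succ, ih]
    simp only [angleR]
    ring

theorem symStructure_mem {p : ℕ} (hp : 3 ≤ p) {d : ℕ → ℝ} (hd : d ∈ posSymSeqs p) :
    symStructure p d ∈ posAngleStructures p := by
  obtain ⟨-, hsym, hpos⟩ := hd
  have hIoo : ∀ i < p, angleR d i ∈ Ioo 0 π ∧ angleB d i ∈ Ioo 0 π ∧ d i ∈ Ioo 0 π := by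
    intro i hi
    obtain ⟨h1, h2, h3⟩ := hpos i hi
    have := angle_sum d i
    exact ⟨⟨h1, by linarith⟩, ⟨h2, by linarith⟩, ⟨h3, by linarith⟩⟩
  have hp1 : d p = d 0 := by simpa using (hsym p le_rfl).symm
  have hB0 := angleB_zero d
  refine ⟨hIoo, fun i h1 h2 => hIoo (p - i) (by omega), hIoo 0 (by omega),
    fun i _ => angle_sum d i, fun i _ _ => angle_sum d (p - i), angle_sum d 0,
    ?_, ?_, ?_, ?_, ?_, ?_, ?_⟩ <;> simp only [symStructure]
  · rw [sum_Icc_one_reflect p (angleR d), Nat.sub_self]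
    obtain ⟨n, rfl⟩ : ∃ n, p = n + 1 := ⟨p - 1, by omega⟩
    have h1 := hsym 1 (by omega)
    rw [Nat.add_sub_cancel] at h1
    rw [sum_angleR, hp1, h1]
    simp only [angleR]
    ring
  · rw [hsym 1 (by omega), Nat.sub_self, hB0]
    ring
  · rw [hsym (p - 1) (by omega), hsym 1 (by omega), Nat.sub_self, hB0]
    ring
  · intro i h1 h2
    rw [hsym (i - 1) (by omega), angleB_reflect hsym (by omega) (by omega),
      angleB_eq (by omega)]
    ring
  · intro i h1 h2
    rw [hsym (i + 1) (by omega), angleB_reflect hsym (by omega) (by omega),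
      angleB_eq (by omega)]
    ring
  · rw [angleB_reflect hsym (by omega) (by omega), angleB_eq le_rfl]
    norm_num
    ring
  · rw [angleB_reflect hsym (i := p - 1) (by omega) (by omega), hsym (p - 2) (by omega),
      angleB_eq (by omega), show p - 1 - 1 = p - 2 by omega, show p - 1 + 1 = p by omega, hp1]
    ring

theorem volFun_symStructure {p : ℕ} (hp : 1 ≤ p) (d : ℕ → ℝ) :
    volFun p (symStructure p d) = symVol p d := by
  have h := sum_Icc_one_reflect p (fun i => tri (angleR d i) (angleB d i) (d i))
  simp only [tri] at h
  obtain ⟨n, rfl⟩ : ∃ n, p = n + 1 := ⟨p - 1, by omega⟩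
  simp only [volFun, symStructure, symVol, h, tri, Finset.sum_range_succ', tetMult,
    ← Finset.mul_sum]
  ring

theorem continuous_volFun (p : ℕ) : Continuous (volFun p) := by
  have := continuous_lob
  unfold volFun
  fun_prop

end Symmetric

section Symmetrization

theorem eq_reflect_of_sub_reflect_periodic {p : ℕ} {G : ℕ → ℝ}
    (hper : ∀ j, j + 2 ≤ p → G j - G (p - j) = G (j + 2) - G (p - (j + 2)))
    (h1 : G 1 = G (p - 1)) : ∀ j ≤ p, G j = G (p - j) := by
  have hodd : ∀ k, 2 * k + 1 ≤ p → G (2 * k + 1) = G (p - (2 * k + 1)) := by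
    intro k
    induction k with
    | zero => exact fun _ => h1
    | succ k ih =>
      intro hk
      have h2 := hper (2 * k + 1) (by omega)
      have h3 := ih (by omega)
      rw [show 2 * (k + 1) + 1 = 2 * k + 1 + 2 by ring]
      linarith
  have heven : ∀ k, 2 * k ≤ p → G (2 * k) - G (p - 2 * k) = G 0 - G p := by
    intro k
    induction k with
    | zero => simp
    | succ k ih =>
      intro hk
      have h2 := hper (2 * k) (by omega)
      have h3 := ih (by omega)
      rw [show 2 * (k + 1) = 2 * k + 2 by ring]
      linarith
  have hends : G 0 = G p := by
    rcases Nat.even_or_odd' p with ⟨k, hk | hk⟩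
    · have := heven k (by omega)
      rw [← hk, Nat.sub_self] at this
      linarith
    · have := hodd k (by omega)
      rw [← hk, Nat.sub_self] at this
      exact this.symm
  intro j hj
  rcases Nat.even_or_odd' j with ⟨k, rfl | rfl⟩
  · have := heven k hj
    linarith
  · exact hodd k hj

theorem tri_add_tri_le {x y z a b c : ℝ} (hx : 0 < x) (hy : 0 < y) (hz : 0 < z)
    (h : x + y + z = π) (ha : 0 < a) (hb : 0 < b) (hc : 0 < c) (h' : a + b + c = π) :
    tri x y z + tri a b c ≤ 2 * tri ((x + a) / 2) ((y + b) / 2) ((z + c) / 2) := by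
  have := tri_segment_ge hx.le hy.le hz.le h ha hb hc h' (t := 1 / 2) (by norm_num) (by norm_num)
  rw [show x + 1 / 2 * (a - x) = (x + a) / 2 by ring,
    show y + 1 / 2 * (b - y) = (y + b) / 2 by ring,
    show z + 1 / 2 * (c - z) = (z + c) / 2 by ring] at this
  linarith

theorem tri_add_tri_add_tri_le {x₁ y₁ z₁ x₂ y₂ z₂ x₃ y₃ z₃ : ℝ}
    (hx₁ : 0 < x₁) (hy₁ : 0 < y₁) (hz₁ : 0 < z₁) (h₁ : x₁ + y₁ + z₁ = π)
    (hx₂ : 0 < x₂) (hy₂ : 0 < y₂) (hz₂ : 0 < z₂) (h₂ : x₂ + y₂ + z₂ = π)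
    (hx₃ : 0 < x₃) (hy₃ : 0 < y₃) (hz₃ : 0 < z₃) (h₃ : x₃ + y₃ + z₃ = π) :
    tri x₁ y₁ z₁ + tri x₂ y₂ z₂ + tri x₃ y₃ z₃
      ≤ 3 * tri ((x₁ + x₂ + x₃) / 3) ((y₁ + y₂ + y₃) / 3) ((z₁ + z₂ + z₃) / 3) := by
  have h12 := tri_add_tri_le hx₁ hy₁ hz₁ h₁ hx₂ hy₂ hz₂ h₂
  have := tri_segment_ge (x := (x₁ + x₂) / 2) (y := (y₁ + y₂) / 2) (z := (z₁ + z₂) / 2)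
    (by positivity) (by positivity) (by positivity) (by linarith) hx₃ hy₃ hz₃ h₃
    (t := 1 / 3) (by norm_num) (by norm_num)
  rw [show (x₁ + x₂) / 2 + 1 / 3 * (x₃ - (x₁ + x₂) / 2) = (x₁ + x₂ + x₃) / 3 by ring,
    show (y₁ + y₂) / 2 + 1 / 3 * (y₃ - (y₁ + y₂) / 2) = (y₁ + y₂ + y₃) / 3 by ring,
    show (z₁ + z₂) / 2 + 1 / 3 * (z₃ - (z₁ + z₂) / 2) = (z₁ + z₂ + z₃) / 3 by ring] at this
  linarith

theorem exists_symSeqs_volFun_le {p : ℕ} (hp : 3 ≤ p) {θ : AngleSpace}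
    (hθ : θ ∈ posAngleStructures p) : ∃ d ∈ symSeqs p, volFun p θ ≤ symVol p d := by
  obtain ⟨R', B', D', R, B, D, Rs, Bs, Ds⟩ := θ
  obtain ⟨hI', hI, ⟨hRs, hBs, hDs⟩, hs', hs, hss, -, E2, E3, E4, E5, E6, E7⟩ := hθ
  dsimp only at hI' hI hRs hBs hDs hs' hs hss E2 E3 E4 E5 E6 E7
  set d : ℕ → ℝ := fun j => if j < p then (D' j + D (p - j)) / 2 else if j = p then Ds else 0
    with hd
  have hdlt : ∀ j < p, d j = (D' j + D (p - j)) / 2 := fun j hj => by simp [hd, hj]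
  have hdp : d p = Ds := by simp [hd]
  have hlow : ∀ i, 1 ≤ i → i < p →
      d (i - 1) + d (p - i - 1) = 2 * π - (B i + B' i + B (p - i) + B' (p - i)) / 2 := by
    intro i h1 h2
    have e1 := E5 i h1 (by omega)
    have e2 := E5 (p - i) (by omega) (by omega)
    rw [hdlt _ (by omega), hdlt _ (by omega), show p - (i - 1) = p - i + 1 by omega,
      show p - (p - i - 1) = i + 1 by omega]
    linarith
  have hhigh : ∀ i, 1 ≤ i → i < p →
      d (i + 1) + d (p - i + 1) = 2 * π - (B i + B' i + B (p - i) + B' (p - i)) / 2 := by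
    intro i h1 h2
    rcases eq_or_lt_of_le h1 with rfl | h1'
    · rw [hdlt _ (by omega), show p - 1 + 1 = p by omega, hdp, show p - (1 + 1) = p - 2 by omega]
      norm_num
      linarith
    rcases eq_or_lt_of_le (show i ≤ p - 1 by omega) with rfl | h2'
    · rw [show p - 1 + 1 = p by omega, show p - (p - 1) = 1 by omega, hdp, hdlt _ (by omega),
        show p - (1 + 1) = p - 2 by omega]
      norm_num
      linarith
    · have e1 := E4 i h1' (by omega)
      have e2 := E4 (p - i) (by omega) (by omega)
      rw [hdlt _ (by omega), hdlt _ (by omega), show p - (p - i + 1) = i - 1 by omega,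
        show p - (i + 1) = p - i - 1 by omega]
      linarith
  have hrefl : ∀ j ≤ p, d j = d (p - j) := by
    refine eq_reflect_of_sub_reflect_periodic (fun j hj => ?_) ?_
    · have e1 := hlow (j + 1) (by omega) (by omega)
      have e2 := hhigh (j + 1) (by omega) (by omega)
      rw [show j + 1 - 1 = j by omega, show p - (j + 1) - 1 = p - (j + 2) by omega] at e1
      rw [show p - (j + 1) + 1 = p - j by omega] at e2
      linarith
    · rw [hdlt _ (by omega), hdlt _ (by omega), show p - (p - 1) = 1 by omega]
      linarith
  have hd0 : d 0 = Ds := by rw [hrefl 0 (by omega), Nat.sub_zero, hdp]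
  have hd0' : D' 0 + D p = 2 * Ds := by
    have := hdlt 0 (by omega)
    rw [hd0, Nat.sub_zero] at this
    linarith
  have hD0 : d 0 = (D' 0 + D p + Ds) / 3 := by linarith
  have hB0 : angleB d 0 = (B' 0 + B p + Bs) / 3 := by
    have h1 := hrefl 1 (by omega)
    rw [hdlt (p - 1) (by omega), show p - (p - 1) = 1 by omega] at h1
    have h2 := hdlt 1 (by omega)
    rw [angleB_zero]
    linarith
  have hR0 : angleR d 0 = (R' 0 + R p + Rs) / 3 := by
    have h1 := angle_sum d 0
    have h2 := hs' 0 (by omega)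
    have h3 := hs p (by omega) le_rfl
    linarith
  have hD : ∀ i, 1 ≤ i → i < p →
      d i = ((D' i + D i) / 2 + (D' (p - i) + D (p - i)) / 2) / 2 := by
    intro i h1 h2
    have h3 := hrefl i h2.le
    have h4 := hdlt i h2
    rw [hdlt (p - i) (by omega), show p - (p - i) = i by omega] at h3
    linarith
  have hB : ∀ i, 1 ≤ i → i < p →
      angleB d i = ((B' i + B i) / 2 + (B' (p - i) + B (p - i)) / 2) / 2 := by
    intro i h1 h2
    have h3 := hlow i h1 h2
    rw [Nat.sub_sub, ← hrefl (i + 1) (by omega)] at h3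
    rw [angleB_eq h1]
    linarith
  have hR : ∀ i, 1 ≤ i → i < p →
      angleR d i = ((R' i + R i) / 2 + (R' (p - i) + R (p - i)) / 2) / 2 := by
    intro i h1 h2
    have e := angle_sum d i
    have e1 := hs' i h2
    have e2 := hs i h1 h2.le
    have e3 := hs' (p - i) (by omega)
    have e4 := hs (p - i) (by omega) (by omega)
    linarith [hD i h1 h2, hB i h1 h2]
  obtain ⟨⟨pR'0, -⟩, ⟨pB'0, -⟩, ⟨pD'0, -⟩⟩ := hI' 0 (by omega)
  obtain ⟨⟨pRp, -⟩, ⟨pBp, -⟩, ⟨pDp, -⟩⟩ := hI p (by omega) le_rfl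
  refine ⟨d, ⟨fun i => ?_, fun i hi => (hrefl i hi).symm, fun i hi => ?_⟩, ?_⟩
  · rcases lt_trichotomy i p with hi | rfl | hi
    · have h1 := (hI' i hi).2.2
      have h2 := (hI (p - i) (by omega) (by omega))
      rcases Nat.eq_zero_or_pos i with rfl | hi0
      · rw [hd0]
        exact ⟨hDs.1.le, hDs.2.le⟩
      · rw [hdlt i hi]
        exact ⟨by linarith [h1.1, h2.2.2.1], by linarith [h1.2, h2.2.2.2]⟩
    · rw [hdp]
      exact ⟨hDs.1.le, hDs.2.le⟩
    · have : d i = 0 := by simp [hd, hi.not_gt, hi.ne']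
      rw [this]
      exact ⟨le_rfl, Real.pi_pos.le⟩
  · rcases Nat.eq_zero_or_pos i with rfl | hi0
    · rw [hR0, hB0]
      have := hRs.1
      have := hBs.1
      constructor <;> positivity
    · obtain ⟨⟨a1, -⟩, ⟨a2, -⟩, -⟩ := hI' i hi
      obtain ⟨⟨a3, -⟩, ⟨a4, -⟩, -⟩ := hI i hi0 hi.le
      obtain ⟨⟨a5, -⟩, ⟨a6, -⟩, -⟩ := hI' (p - i) (by omega)
      obtain ⟨⟨a7, -⟩, ⟨a8, -⟩, -⟩ := hI (p - i) (by omega) (by omega)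
      rw [hR i hi0 hi, hB i hi0 hi]
      constructor <;> positivity
  · have hzero := tri_add_tri_add_tri_le pR'0 pB'0 pD'0 (hs' 0 (by omega)) pRp pBp pDp
      (hs p (by omega) le_rfl) hRs.1 hBs.1 hDs.1 hss
    rw [← hR0, ← hB0, ← hD0] at hzero
    have hterm : ∀ i, 1 ≤ i → i < p →
        (tri (R' i) (B' i) (D' i) + tri (R i) (B i) (D i))
          + (tri (R' (p - i)) (B' (p - i)) (D' (p - i))
            + tri (R (p - i)) (B (p - i)) (D (p - i)))
          ≤ 4 * tri (angleR d i) (angleB d i) (d i) := by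
      intro i hi0 hi
      obtain ⟨⟨a1, -⟩, ⟨a2, -⟩, ⟨a3, -⟩⟩ := hI' i hi
      obtain ⟨⟨b1, -⟩, ⟨b2, -⟩, ⟨b3, -⟩⟩ := hI i hi0 hi.le
      obtain ⟨⟨c1, -⟩, ⟨c2, -⟩, ⟨c3, -⟩⟩ := hI' (p - i) (by omega)
      obtain ⟨⟨d1, -⟩, ⟨d2, -⟩, ⟨d3, -⟩⟩ := hI (p - i) (by omega) (by omega)
      have sa := hs' i hi
      have sb := hs i hi0 hi.le
      have sc := hs' (p - i) (by omega)
      have sd := hs (p - i) (by omega) (by omega)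
      have t1 := tri_add_tri_le a1 a2 a3 sa b1 b2 b3 sb
      have t2 := tri_add_tri_le c1 c2 c3 sc d1 d2 d3 sd
      have t3 := tri_add_tri_le (half_pos (add_pos a1 b1)) (half_pos (add_pos a2 b2))
        (half_pos (add_pos a3 b3)) (by linarith) (half_pos (add_pos c1 d1))
        (half_pos (add_pos c2 d2)) (half_pos (add_pos c3 d3)) (by linarith)
      rw [← hR i hi0 hi, ← hB i hi0 hi, ← hD i hi0 hi] at t3
      linarith
    obtain ⟨n, rfl⟩ : ∃ n, p = n + 1 := ⟨p - 1, by omega⟩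
    set X : ℕ → ℝ := fun i => tri (R' i) (B' i) (D' i) + tri (R i) (B i) (D i) with hX
    have hreflect : ∑ i ∈ Finset.range n, X (n + 1 - (i + 1))
        = ∑ i ∈ Finset.range n, X (i + 1) := by
      rw [← Finset.sum_range_reflect (fun i => X (i + 1)) n]
      refine Finset.sum_congr rfl fun i hi => ?_
      have := Finset.mem_range.1 hi
      congr 1
      omega
    have hsum : 2 * ∑ i ∈ Finset.range n, X (i + 1)
        ≤ 4 * ∑ i ∈ Finset.range n, tri (angleR d (i + 1)) (angleB d (i + 1)) (d (i + 1)) := by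
      rw [two_mul]
      nth_rewrite 2 [← hreflect]
      rw [← Finset.sum_add_distrib, Finset.mul_sum]
      refine Finset.sum_le_sum fun i hi => ?_
      have := Finset.mem_range.1 hi
      exact hterm (i + 1) (by omega) (by omega)
    have hIcc : ∀ f : ℕ → ℝ, ∑ i ∈ Finset.Icc 1 (n + 1), f i
        = (∑ i ∈ Finset.range n, f (i + 1)) + f (n + 1) := by
      intro f
      rw [← Finset.sum_range_succ (fun i => f (i + 1)), Finset.range_eq_Ico,
        Finset.sum_Ico_add' f 0 (n + 1) 1]
      rfl
    have hvol : volFun (n + 1) (R', B', D', R, B, D, Rs, Bs, Ds)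
        = (tri (R' 0) (B' 0) (D' 0) + tri (R (n + 1)) (B (n + 1)) (D (n + 1)) + tri Rs Bs Ds)
          + ∑ i ∈ Finset.range n, X (i + 1) := by
      simp only [volFun, hIcc, hX, tri, Finset.sum_range_succ' _ n, Finset.sum_add_distrib]
      ring
    rw [hvol, symVol, Finset.sum_range_succ']
    simp only [tetMult, ← Finset.mul_sum]
    linarith

end Symmetrization

/-- For every `p ≥ 3` the set of positive angle structures for `τ_p` is nonempty, and the
volume functional attains its maximum over the closure of this set at a point of the set
itself: there is an `α` in the set (so with all of its entries in `(0,π)`) such that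
`𝒱(β) ≤ 𝒱(α)` for every `β` in the closure. -/
theorem volume_attains_max_at_positive_structure (p : ℕ) (hp : 3 ≤ p) :
    (posAngleStructures p).Nonempty ∧
      ∃ α ∈ posAngleStructures p,
        ∀ β ∈ closure (posAngleStructures p), volFun p β ≤ volFun p α := by
  have hne : (symSeqs p).Nonempty := (posSymSeqs_nonempty hp).mono (posSymSeqs_subset p)
  obtain ⟨d, hd, hmax⟩ :=
    (isCompact_symSeqs p).exists_isMaxOn hne (continuous_symVol p).continuousOn
  have hmem := symStructure_mem hp (mem_posSymSeqs_of_isMaxOn hp hd hmax)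
  refine ⟨⟨_, hmem⟩, _, hmem, ?_⟩
  have hsub : closure (posAngleStructures p)
      ⊆ {β | volFun p β ≤ volFun p (symStructure p d)} := by
    refine closure_minimal (fun β hβ => ?_)
      (isClosed_le (continuous_volFun p) continuous_const)
    obtain ⟨d', hd', hle⟩ := exists_symSeqs_volFun_le hp hβ
    refine mem_ofPred_eq ▸ ?_
    rw [volFun_symStructure (by omega)]
    exact hle.trans (hmax hd')
  exact fun β hβ => hsub hβ
end

section
/- For every integer p ≥ 3, there exists a positive angle structure for the edge-equation system of τ_p; that is, the linear system (E1)–(E7) together with the triple-sum conditions admits a solution with every entry in the open interval (0,π). -/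
open Real

/-- For every integer `p ≥ 3`, the edge-equation system of `τ_p` admits a positive
angle structure. -/
theorem exists_positive_angle_structure (p : ℕ) (hp : 3 ≤ p) :
    ∃ (R' B' D' R B D : ℕ → ℝ) (Rs Bs Ds : ℝ),
      IsPosAngleStructure p R' B' D' R B D Rs Bs Ds := by
  -- `D` is a symmetric quadratic in `i` and `R` is half its (constant) second difference.
  set r : ℝ := π / (2 * p ^ 2) with hr
  set d : ℕ → ℝ := fun i => π / 4 + π * (2 * i - p) ^ 2 / (8 * p ^ 2) with hd
  have hπ := Real.pi_pos
  have hp3 : (3 : ℝ) ≤ p := by exact_mod_cast hp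
  have hp0 : (p : ℝ) ≠ 0 := by positivity
  have hr0 : 0 < r := by positivity
  have hr1 : r ≤ π / 18 := by
    rw [hr]
    gcongr
    nlinarith
  have hd0 : ∀ i, π / 4 ≤ d i := fun i => le_add_of_nonneg_right (by positivity)
  have hd1 : ∀ i ≤ p, d i ≤ 3 * π / 8 := by
    intro i hi
    have hi' : (i : ℝ) ≤ p := by exact_mod_cast hi
    have hsq : (2 * (i : ℝ) - p) ^ 2 ≤ p ^ 2 := by
      nlinarith [mul_nonneg (Nat.cast_nonneg (α := ℝ) i) (sub_nonneg.2 hi')]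
    have : π * (2 * (i : ℝ) - p) ^ 2 / (8 * p ^ 2) ≤ π / 8 := by
      rw [div_le_div_iff₀ (by positivity) (by norm_num)]
      nlinarith
    simp only [hd]
    linarith
  have hs0 : 0 < π / p := by positivity
  have hs1 : π / p ≤ π / 3 := by gcongr
  have hpos : ∀ i ≤ p, r ∈ Set.Ioo 0 π ∧ π - d i - r ∈ Set.Ioo 0 π ∧ d i ∈ Set.Ioo 0 π := by
    intro i hi
    have := hd0 i
    have := hd1 i hi
    refine ⟨⟨?_, ?_⟩, ⟨?_, ?_⟩, ⟨?_, ?_⟩⟩ <;> linarith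
  refine ⟨fun _ => r, fun i => π - d i - r, d, fun _ => r, fun i => π - d i - r, d,
    5 * π / 8 - π / p, π / p, 3 * π / 8, fun i hi => hpos i hi.le, fun i _ hi => hpos i hi,
    ⟨⟨?_, ?_⟩, ⟨?_, ?_⟩, ⟨?_, ?_⟩⟩, fun i _ => by ring, fun i _ _ => by ring, by ring,
    ?_, ?_, ?_, ?_, ?_, ?_, ?_⟩
  any_goals linarith
  · simp only [Finset.sum_const, Finset.card_range, Nat.card_Icc, Nat.add_sub_cancel,
      nsmul_eq_mul, hd, hr]
    push_cast
    field_simp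
    ring
  · simp only [hd, hr, Nat.cast_sub (show 1 ≤ p by omega)]
    push_cast
    field_simp
    ring
  · simp only [hd, hr, Nat.cast_sub (show 1 ≤ p by omega)]
    push_cast
    field_simp
    ring
  · intro i hi _
    simp only [hd, hr, Nat.cast_sub (show 1 ≤ i by omega)]
    push_cast
    field_simp
    ring
  · intro i hi _
    simp only [hd, hr, Nat.cast_sub hi]
    push_cast
    field_simp
    ring
  · simp only [hd, hr]
    push_cast
    field_simp
    ring
  · simp only [hd, hr, Nat.cast_sub (show 1 ≤ p by omega), Nat.cast_sub (show 2 ≤ p by omega)]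
    push_cast
    field_simp
    ring
end

section
/- Fix an integer p ≥ 3 and a family of triples (R_i, B_i, D_i) for i = 1,…,p and (R_s, B_s, D_s) with every entry in [0,π] and every triple summing to π, satisfying Property 1 and the symmetric edge equations. If at least one entry of the family equals 0 or π, then every one of the p+1 triples is flat. -/
open Real

/-- A triple of angles is *flat* if it is a permutation of `(0, 0, π)`. -/
def IsFlat (x y z : ℝ) : Prop := ({x, y, z} : Multiset ℝ) = ({0, 0, π} : Multiset ℝ)

/-- The family consists of triples with entries in `[0,π]`, each summing to `π`. -/
def InRangeFamily (p : ℕ) (R B D : ℕ → ℝ) (Rs Bs Ds : ℝ) : Prop :=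
  (∀ i, 1 ≤ i → i ≤ p →
    (R i ∈ Set.Icc 0 π ∧ B i ∈ Set.Icc 0 π ∧ D i ∈ Set.Icc 0 π) ∧ R i + B i + D i = π) ∧
  (Rs ∈ Set.Icc 0 π ∧ Bs ∈ Set.Icc 0 π ∧ Ds ∈ Set.Icc 0 π) ∧ Rs + Bs + Ds = π

/-- Property 1: each of the `p+1` triples either has all entries in `(0,π)` or is flat. -/
def Property1 (p : ℕ) (R B D : ℕ → ℝ) (Rs Bs Ds : ℝ) : Prop :=
  (∀ i, 1 ≤ i → i ≤ p →
    ((R i ∈ Set.Ioo 0 π ∧ B i ∈ Set.Ioo 0 π ∧ D i ∈ Set.Ioo 0 π) ∨ IsFlat (R i) (B i) (D i))) ∧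
  ((Rs ∈ Set.Ioo 0 π ∧ Bs ∈ Set.Ioo 0 π ∧ Ds ∈ Set.Ioo 0 π) ∨ IsFlat Rs Bs Ds)

/-- The symmetric edge equations (with `k = ⌊p/2⌋`). -/
def SymEdgeEqs (p : ℕ) (R B D : ℕ → ℝ) (Rs Bs Ds : ℝ) : Prop :=
  -- (1)
  (4 * ∑ i ∈ Finset.Icc 1 p, R i + 2 * Rs + 2 * D p = 2 * π) ∧
  -- (2)
  (2 * B p + 2 * D 1 + Bs = 2 * π) ∧
  -- (3)
  (2 * B p + 2 * D (p - 1) + Bs = 2 * π) ∧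
  -- (4)
  (∀ i, 2 ≤ i → i ≤ p / 2 → D (i - 1) + B i + B (p - i) + D (p - i - 1) = 2 * π) ∧
  -- (5)
  (∀ i, 1 ≤ i → i ≤ p / 2 → D (p - i + 1) + B i + B (p - i) + D (i + 1) = 2 * π) ∧
  -- (6)
  (Ds + B (p - 1) + B 1 + D (p - 2) = 2 * π) ∧
  -- (7)
  (Ds = D p) ∧ (∀ i, 1 ≤ i → i ≤ p / 2 → D i = D (p - i))

theorem IsFlat.mem_zero_pi {x y z : ℝ} (h : IsFlat x y z) :
    (x = 0 ∨ x = π) ∧ (y = 0 ∨ y = π) ∧ (z = 0 ∨ z = π) := by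
  have key : ∀ w ∈ ({x, y, z} : Multiset ℝ), w = 0 ∨ w = π := by
    intro w hw
    rw [h] at hw
    simpa using hw
  exact ⟨key x (by simp), key y (by simp), key z (by simp)⟩

theorem isFlat_of_boundary_entry {x y z : ℝ}
    (h : (x ∈ Set.Ioo 0 π ∧ y ∈ Set.Ioo 0 π ∧ z ∈ Set.Ioo 0 π) ∨ IsFlat x y z)
    (hb : x = 0 ∨ x = π ∨ y = 0 ∨ y = π ∨ z = 0 ∨ z = π) : IsFlat x y z := by
  rcases h with ⟨⟨hx₀, hx₁⟩, ⟨hy₀, hy₁⟩, hz₀, hz₁⟩ | h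
  · rcases hb with h | h | h | h | h | h <;> linarith
  · exact h

/-- The first and second edge equations bound the red angles and relate their sum to the
angles of the triple `p`. -/
theorem InRangeFamily.red_sum {p : ℕ} (hp : 3 ≤ p) {R B D : ℕ → ℝ} {Rs Bs Ds : ℝ}
    (hrange : InRangeFamily p R B D Rs Bs Ds) (heqs : SymEdgeEqs p R B D Rs Bs Ds) :
    (∀ i, 1 ≤ i → i ≤ p → R i ≤ ∑ j ∈ Finset.Icc 1 p, R j) ∧
      2 * ∑ j ∈ Finset.Icc 1 p, R j + D p ≤ π ∧
      D 1 + ∑ j ∈ Finset.Icc 1 p, R j = R p + D p := by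
  obtain ⟨hfam, ⟨hRs, hBs, hDs⟩, hsum⟩ := hrange
  obtain ⟨e1, e2, -, -, -, -, e7, -⟩ := heqs
  have hsp := (hfam p (by omega) le_rfl).2
  refine ⟨fun i hi hip => ?_, by linarith [hRs.1], by linarith⟩
  refine Finset.single_le_sum (f := R) (fun j hj => ?_) (Finset.mem_Icc.2 ⟨hi, hip⟩)
  rw [Finset.mem_Icc] at hj
  exact (hfam j hj.1 hj.2).1.1.1

theorem InRangeFamily.red_eq_zero_of_isFlat {p : ℕ} (hp : 3 ≤ p) {R B D : ℕ → ℝ}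
    {Rs Bs Ds : ℝ} (hrange : InRangeFamily p R B D Rs Bs Ds)
    (heqs : SymEdgeEqs p R B D Rs Bs Ds) {i : ℕ} (hi : 1 ≤ i) (hip : i ≤ p)
    (h : IsFlat (R i) (B i) (D i)) : R i = 0 := by
  obtain ⟨hle, hS, -⟩ := hrange.red_sum hp heqs
  rcases h.mem_zero_pi.1 with h0 | hπ
  · exact h0
  · linarith [hle i hi hip, (hrange.1 p (by omega) le_rfl).1.2.2.1, pi_pos]

/-- A boundary value of `D i` with `i ≤ p / 2` propagates through the edge equations down to
`D p`. -/
theorem boundary_entry_last {p : ℕ} (hp : 3 ≤ p) {R B D : ℕ → ℝ} {Rs Bs Ds : ℝ}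
    (hrange : InRangeFamily p R B D Rs Bs Ds) (hprop1 : Property1 p R B D Rs Bs Ds)
    (heqs : SymEdgeEqs p R B D Rs Bs Ds) {i : ℕ} (hi : 1 ≤ i) (hik : i ≤ p / 2)
    (h : D i = 0 ∨ D i = π) : D p = 0 ∨ D p = π := by
  have hred : ∀ j, 1 ≤ j → j ≤ p → D j = 0 → R j = 0 := fun j hj hjp h0 =>
    hrange.red_eq_zero_of_isFlat hp heqs hj hjp
      (isFlat_of_boundary_entry (hprop1.1 j hj hjp) (by tauto))
  obtain ⟨-, -, -, -, e5, -, -, e7⟩ := id heqs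
  obtain ⟨hfam, -⟩ := id hrange
  induction i, hi using Nat.le_induction with
  | base =>
    obtain ⟨⟨hR, -, -⟩, hs⟩ := hfam 1 le_rfl (by omega)
    obtain ⟨⟨hR', -, -⟩, hs'⟩ := hfam (p - 1) (by omega) (by omega)
    obtain ⟨⟨-, -, hD₂⟩, -⟩ := hfam (1 + 1) (by omega) (by omega)
    obtain ⟨⟨-, -, hD⟩, -⟩ := hfam p (by omega) le_rfl
    have e := e5 1 le_rfl hik
    have s := e7 1 le_rfl hik
    rw [show p - 1 + 1 = p by omega] at e
    rcases h with h | h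
    · left
      have := hred 1 le_rfl (by omega) h
      have := hred (p - 1) (by omega) (by omega) (s ▸ h)
      linarith [hD.1, hD₂.1]
    · right
      linarith [hD.2, hD₂.2, hR.1, hR'.1]
  | succ n hn ih =>
    obtain ⟨⟨hR, -, -⟩, hs⟩ := hfam (n + 1) (by omega) (by omega)
    obtain ⟨⟨hR', -, -⟩, hs'⟩ := hfam (p - (n + 1)) (by omega) (by omega)
    obtain ⟨⟨-, -, hD₂⟩, -⟩ := hfam (n + 1 + 1) (by omega) (by omega)
    obtain ⟨⟨-, -, hD⟩, -⟩ := hfam n hn (by omega)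
    have e := e5 (n + 1) (by omega) hik
    have s := e7 (n + 1) (by omega) hik
    rw [show p - (n + 1) + 1 = p - n by omega, ← e7 n hn (by omega)] at e
    refine ih (by omega) ?_
    rcases h with h | h
    · left
      have := hred (n + 1) (by omega) (by omega) h
      have := hred (p - (n + 1)) (by omega) (by omega) (s ▸ h)
      linarith [hD.1, hD₂.1]
    · right
      linarith [hD.2, hD₂.2, hR.1, hR'.1]

/-- If the family satisfies Property 1 and the symmetric edge equations, and some entry
of the family equals `0` or `π`, then every one of the `p+1` triples is flat. -/
theorem all_flat_of_some_boundary_entry (p : ℕ) (hp : 3 ≤ p)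
    (R B D : ℕ → ℝ) (Rs Bs Ds : ℝ)
    (hrange : InRangeFamily p R B D Rs Bs Ds)
    (hprop1 : Property1 p R B D Rs Bs Ds)
    (heqs : SymEdgeEqs p R B D Rs Bs Ds)
    (hboundary :
      (∃ i, 1 ≤ i ∧ i ≤ p ∧
        (R i = 0 ∨ R i = π ∨ B i = 0 ∨ B i = π ∨ D i = 0 ∨ D i = π)) ∨
      (Rs = 0 ∨ Rs = π ∨ Bs = 0 ∨ Bs = π ∨ Ds = 0 ∨ Ds = π)) :
    (∀ i, 1 ≤ i → i ≤ p → IsFlat (R i) (B i) (D i)) ∧ IsFlat Rs Bs Ds := by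
  obtain ⟨hle, hS, hlast⟩ := hrange.red_sum hp heqs
  obtain ⟨-, -, -, -, -, -, hDs, hsymm⟩ := id heqs
  have hDp : D p = 0 ∨ D p = π := by
    rcases hboundary with ⟨i, hi, hip, hb⟩ | hb
    · have hD := (isFlat_of_boundary_entry (hprop1.1 i hi hip) hb).mem_zero_pi.2.2
      rcases hip.eq_or_lt with rfl | hlt
      · exact hD
      · by_cases hik : i ≤ p / 2
        · exact boundary_entry_last hp hrange hprop1 heqs hi hik hD
        · refine boundary_entry_last hp hrange hprop1 heqs (i := p - i) (by omega) (by omega) ?_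
          rwa [hsymm (p - i) (by omega) (by omega), show p - (p - i) = i by omega]
    · exact hDs ▸ (isFlat_of_boundary_entry hprop1.2 hb).mem_zero_pi.2.2
  have hflat := isFlat_of_boundary_entry (hprop1.1 p (by omega) le_rfl) (by tauto)
  have hRp := hrange.red_eq_zero_of_isFlat hp heqs (by omega) le_rfl hflat
  have hD₁ := (hrange.1 1 le_rfl (by omega)).1.2.2.1
  have hsum : ∑ j ∈ Finset.Icc 1 p, R j ≤ 0 := by
    rcases hDp with h | h <;> linarith
  refine ⟨fun i hi hip => isFlat_of_boundary_entry (hprop1.1 i hi hip) (Or.inl ?_),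
    isFlat_of_boundary_entry hprop1.2 ?_⟩
  · linarith [hle i hi hip, (hrange.1 i hi hip).1.1.1]
  · rw [← hDs] at hDp
    tauto
end

section
/- Fix an integer p ≥ 3 and a family of triples (R_i, B_i, D_i) for i = 1,…,p and (R_s, B_s, D_s) with every entry in [0,π] and every triple summing to π, satisfying Property 1 and the symmetric edge equations. If the triple (R_p, B_p, D_p) is flat or the triple (R_s, B_s, D_s) is flat, then every one of the p+1 triples is flat. -/
open Real

/-- A flat triple is one of the three arrangements of `(0, 0, π)`. -/
theorem IsFlat.eq_cases {x y z : ℝ} (h : IsFlat x y z) :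
    (x = 0 ∧ y = 0 ∧ z = π) ∨ (x = 0 ∧ y = π ∧ z = 0) ∨ (x = π ∧ y = 0 ∧ z = 0) := by
  have hπ := Real.pi_ne_zero
  have hx : x ∈ ({0, 0, π} : Multiset ℝ) := h ▸ by simp
  have hy : y ∈ ({0, 0, π} : Multiset ℝ) := h ▸ by simp
  have hsum : x + (y + z) = π := by simpa using congrArg Multiset.sum h
  have hz : z ∈ ({0, 0, π} : Multiset ℝ) := h ▸ by simp
  simp only [Multiset.insert_eq_cons, Multiset.mem_cons, Multiset.mem_singleton] at hx hy hz
  grind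

/-- A triple with Property 1 whose last entry is `0` or `π` is flat. -/
theorem isFlat_of_eq_zero_or_pi {x y z : ℝ}
    (h : (x ∈ Set.Ioo 0 π ∧ y ∈ Set.Ioo 0 π ∧ z ∈ Set.Ioo 0 π) ∨ IsFlat x y z)
    (hz : z = 0 ∨ z = π) : IsFlat x y z := by
  rcases h with ⟨-, -, h0, h1⟩ | h
  · rcases hz with rfl | rfl
    · exact absurd h0 (lt_irrefl _)
    · exact absurd h1 (lt_irrefl _)
  · exact h

/-- If all the `R i` vanish, the edge equations force `D` to be constant once `D p = D 1`. -/
theorem eq_const_of_edge_eqs {p : ℕ} {R B D : ℕ → ℝ} {c : ℝ}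
    (hsum : ∀ i, 1 ≤ i → i ≤ p → R i + B i + D i = π)
    (hR : ∀ i, 1 ≤ i → i ≤ p → R i = 0)
    (hedge : ∀ i, 1 ≤ i → i ≤ p / 2 → D (p - i + 1) + B i + B (p - i) + D (i + 1) = 2 * π)
    (hsymm : ∀ i, 1 ≤ i → i ≤ p / 2 → D i = D (p - i))
    (hp : D p = c) (h1 : D 1 = c) : ∀ i, 1 ≤ i → i ≤ p → D i = c := by
  have half : ∀ i, 1 ≤ i → i ≤ p / 2 → D i = c := by
    intro i
    induction i using Nat.strong_induction_on with
    | _ i ih =>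
      intro hi hik
      obtain rfl | hi2 := hi.eq_or_lt
      · exact h1
      obtain ⟨j, rfl⟩ : ∃ j, i = j + 1 := ⟨i - 1, by omega⟩
      have hj := ih j (by omega) (by omega) (by omega)
      have hpj := hsymm j (by omega) (by omega)
      have hprev : D (p - j + 1) = c := by
        obtain rfl | hj2 := (show 1 ≤ j by omega).eq_or_lt
        · rwa [show p - 1 + 1 = p by omega]
        · rw [show p - j + 1 = p - (j - 1) by omega,
            ← hsymm (j - 1) (by omega) (by omega)]
          exact ih (j - 1) (by omega) (by omega) (by omega)
      have := hedge j (by omega) (by omega)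
      have := hsum j (by omega) (by omega)
      have := hsum (p - j) (by omega) (by omega)
      have := hR j (by omega) (by omega)
      have := hR (p - j) (by omega) (by omega)
      linarith
  intro i hi hip
  by_cases hik : i ≤ p / 2
  · exact half i hi hik
  obtain rfl | hlt := hip.eq_or_lt
  · exact hp
  have := hsymm (p - i) (by omega) (by omega)
  rw [show p - (p - i) = i by omega] at this
  rw [← this]
  exact half (p - i) (by omega) (by omega)

/-- If the family satisfies Property 1 and the symmetric edge equations, and the triple
`(R_p, B_p, D_p)` or the triple `(R_s, B_s, D_s)` is flat, then every triple is flat. -/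
theorem all_flat_of_wp_or_s_flat (p : ℕ) (hp : 3 ≤ p)
    (R B D : ℕ → ℝ) (Rs Bs Ds : ℝ)
    (hrange : InRangeFamily p R B D Rs Bs Ds)
    (hprop1 : Property1 p R B D Rs Bs Ds)
    (heqs : SymEdgeEqs p R B D Rs Bs Ds)
    (hflat : IsFlat (R p) (B p) (D p) ∨ IsFlat Rs Bs Ds) :
    (∀ i, 1 ≤ i → i ≤ p → IsFlat (R i) (B i) (D i)) ∧ IsFlat Rs Bs Ds := by
  obtain ⟨htri, ⟨hRs, hBs, hDs⟩, hsums⟩ := hrange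
  obtain ⟨hprop, hprops⟩ := hprop1
  obtain ⟨h1, h2, -, -, h5, -, hDsp, hsymm⟩ := heqs
  have hπ := Real.pi_pos
  have hR0 : ∀ i ∈ Finset.Icc 1 p, 0 ≤ R i := fun i hi =>
    (htri i (Finset.mem_Icc.1 hi).1 (Finset.mem_Icc.1 hi).2).1.1.1
  have hp_mem : p ∈ Finset.Icc 1 p := Finset.mem_Icc.2 ⟨by omega, le_rfl⟩
  have hRp := Finset.single_le_sum hR0 hp_mem
  have hflatp : IsFlat (R p) (B p) (D p) := by
    rcases hflat with h | h
    · exact h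
    · refine isFlat_of_eq_zero_or_pi (hprop p (by omega) le_rfl) ?_
      rw [← hDsp]
      rcases h.eq_cases with ⟨-, -, h⟩ | ⟨-, -, h⟩ | ⟨-, -, h⟩ <;> simp [h]
  have hDp : (D p = 0 ∨ D p = π) ∧ D 1 = D p ∧ ∑ i ∈ Finset.Icc 1 p, R i = 0 := by
    have hD1 := (htri 1 le_rfl (by omega)).1.2.2
    have hD0 := hD1.1
    have hDπ := hD1.2
    have hS := Finset.sum_nonneg hR0
    have hRs0 := hRs.1
    have hBs0 := hBs.1
    rcases hflatp.eq_cases with ⟨-, hB, hD⟩ | ⟨-, hB, hD⟩ | ⟨hR, -, hD⟩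
    · exact ⟨Or.inr hD, by linarith, by linarith⟩
    · exact ⟨Or.inl hD, by linarith, by linarith⟩
    · linarith
  obtain ⟨hDp, hD1, hS⟩ := hDp
  have hRzero := (Finset.sum_eq_zero_iff_of_nonneg hR0).1 hS
  have hconst := eq_const_of_edge_eqs (fun i hi hip => (htri i hi hip).2)
    (fun i hi hip => hRzero i (Finset.mem_Icc.2 ⟨hi, hip⟩)) h5 hsymm rfl hD1
  exact ⟨fun i hi hip => isFlat_of_eq_zero_or_pi (hprop i hi hip) (hconst i hi hip ▸ hDp),
    isFlat_of_eq_zero_or_pi hprops (hDsp ▸ hDp)⟩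
end

section
/- Fix an integer p ≥ 3 and suppose the family of triples (R'_i, B'_i, D'_i), (R_i, B_i, D_i), (R_s, B_s, D_s) is a positive angle structure for the edge-equation system of τ_p. Then the family ιθ defined by (R'_i, B'_i, D'_i)_new = (R_{p−i}, B_{p−i}, D_{p−i}) for i = 0,…,p−1, (R_i, B_i, D_i)_new = (R'_{p−i}, B'_{p−i}, D'_{p−i}) for i = 1,…,p, and (R_s, B_s, D_s)_new = (R_s, B_s, D_s), is also a positive angle structure for the same system. -/
open Real

theorem sum_range_reflect_eq_sum_Icc {M : Type*} [AddCommMonoid M] (p : ℕ) (f : ℕ → M) :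
    ∑ i ∈ Finset.range p, f (p - i) = ∑ i ∈ Finset.Icc 1 p, f i := by
  refine Finset.sum_nbij' (fun i => p - i) (fun i => p - i) ?_ ?_ ?_ ?_ fun _ _ => rfl <;>
    intro i hi <;> simp only [Finset.mem_range, Finset.mem_Icc] at hi ⊢ <;> omega

theorem sum_Icc_reflect_eq_sum_range {M : Type*} [AddCommMonoid M] (p : ℕ) (f : ℕ → M) :
    ∑ i ∈ Finset.Icc 1 p, f (p - i) = ∑ i ∈ Finset.range p, f i := by
  refine Finset.sum_nbij' (fun i => p - i) (fun i => p - i) ?_ ?_ ?_ ?_ fun _ _ => rfl <;>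
    intro i hi <;> simp only [Finset.mem_range, Finset.mem_Icc] at hi ⊢ <;> omega

/-- The involution `ι` — which swaps the primed triple indexed by `i` with the unprimed
triple indexed by `p - i` and fixes the triple of `s` — carries positive angle
structures for `τ_p` to positive angle structures for `τ_p`. -/
theorem involution_preserves_angle_structures (p : ℕ) (hp : 3 ≤ p)
    (R' B' D' R B D : ℕ → ℝ) (Rs Bs Ds : ℝ)
    (h : IsPosAngleStructure p R' B' D' R B D Rs Bs Ds) :
    IsPosAngleStructure p
      (fun i => R (p - i)) (fun i => B (p - i)) (fun i => D (p - i))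
      (fun i => R' (p - i)) (fun i => B' (p - i)) (fun i => D' (p - i))
      Rs Bs Ds := by
  obtain ⟨pos', pos, pos_s, sum', sum, sum_s, e1, e2, e3, e4, e5, e6, e7⟩ := h
  have h1 : p - (p - 1) = 1 := by omega
  have h2 : p - (p - 2) = 2 := by omega
  refine ⟨fun i hi => pos _ (by omega) (by omega), fun i h1 hi => pos' _ (by omega), pos_s,
    fun i hi => sum _ (by omega) (by omega), fun i h1 hi => sum' _ (by omega), sum_s,
    ?_, ?_, ?_, fun i hi hip => ?_, fun i hi hip => ?_, ?_, ?_⟩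
  · simp only [sum_range_reflect_eq_sum_Icc, sum_Icc_reflect_eq_sum_range, Nat.sub_zero,
      Nat.sub_self]
    linarith
  · simp only [Nat.sub_zero, Nat.sub_self, h1]
    linarith
  · simp only [Nat.sub_zero, Nat.sub_self, h1]
    linarith
  · have := e4 (p - i) (by omega) (by omega)
    simp only [show p - (i - 1) = p - i + 1 by omega, show p - (i + 1) = p - i - 1 by omega]
    linarith
  · have := e5 (p - i) (by omega) (by omega)
    simp only [show p - (i - 1) = p - i + 1 by omega, show p - (i + 1) = p - i - 1 by omega]
    linarith
  · linarith
  · simp only [h1, h2]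
    linarith
end

section
/- Fix an integer p ≥ 3, let k = ⌊p/2⌋, and suppose the family of triples (R'_i, B'_i, D'_i), (R_i, B_i, D_i), (R_s, B_s, D_s) is a positive angle structure for the edge-equation system of τ_p which moreover satisfies R'_i = R_{p−i}, B'_i = B_{p−i}, and D'_i = D_{p−i} for all i = 0,…,p−1. Then D_p = D_s, and D_i = D_{p−i} for every i = 1,…,k. -/
open Real

/-- A 2-periodic sequence on `{1,…,p-1}` that is odd under `i ↦ p - i` and starts at zero
vanishes identically. -/
theorem eq_zero_of_periodic_of_antisymm {p : ℕ} {e : ℕ → ℝ} (h1 : e 1 = 0)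
    (hanti : ∀ i, 1 ≤ i → i < p → e (p - i) = -e i)
    (hstep : ∀ i, 1 ≤ i → i + 2 < p → e (i + 2) = e i) :
    ∀ i, 1 ≤ i → i < p → e i = 0 := by
  have hodd : ∀ n, 2 * n + 1 < p → e (2 * n + 1) = 0 := by
    intro n
    induction n with
    | zero => exact fun _ => h1
    | succ n ih =>
      intro hn
      rw [show 2 * (n + 1) + 1 = 2 * n + 1 + 2 by ring, hstep _ (by omega) (by omega)]
      exact ih (by omega)
  have heven : ∀ n, 2 * n + 2 < p → e (2 * n + 2) = e 2 := by
    intro n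
    induction n with
    | zero => exact fun _ => rfl
    | succ n ih =>
      intro hn
      rw [show 2 * (n + 1) + 2 = 2 * n + 2 + 2 by ring, hstep _ (by omega) (by omega)]
      exact ih (by omega)
  intro i hi hip
  rcases Nat.even_or_odd' i with ⟨n, rfl | rfl⟩
  · rcases Nat.even_or_odd' p with ⟨m, rfl | rfl⟩
    · have ha := hanti (2 * n) hi hip
      have hb := heven (n - 1) (by omega)
      have hc := heven (m - n - 1) (by omega)
      rw [show 2 * (n - 1) + 2 = 2 * n by omega] at hb
      rw [show 2 * (m - n - 1) + 2 = 2 * m - 2 * n by omega] at hc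
      linarith
    · have ha := hanti (2 * n) hi hip
      have hb := hodd (m - n) (by omega)
      rw [show 2 * (m - n) + 1 = 2 * m + 1 - 2 * n by omega] at hb
      linarith
  · exact hodd n hip

/-- For a positive angle structure on `τ_p` that is symmetric under the involution `ι`
(i.e. `R'_i = R_{p-i}`, `B'_i = B_{p-i}`, `D'_i = D_{p-i}` for `i = 0,…,p-1`), the
diagonal angles satisfy `D_p = D_s` and `D_i = D_{p-i}` for `i = 1,…,⌊p/2⌋`. -/
theorem symmetric_structure_diagonal_equalities (p : ℕ) (hp : 3 ≤ p)
    (R' B' D' R B D : ℕ → ℝ) (Rs Bs Ds : ℝ)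
    (h : IsPosAngleStructure p R' B' D' R B D Rs Bs Ds)
    (hsym : ∀ i < p, R' i = R (p - i) ∧ B' i = B (p - i) ∧ D' i = D (p - i)) :
    D p = Ds ∧ ∀ i, 1 ≤ i → i ≤ p / 2 → D i = D (p - i) := by
  obtain ⟨-, -, -, -, -, -, -, h2, h3, h4, h5, h6, -⟩ := h
  have hD : ∀ i < p, D' i = D (p - i) := fun i hi => (hsym i hi).2.2
  have key : ∀ i, 1 ≤ i → i < p → D i - D (p - i) = 0 := by
    refine eq_zero_of_periodic_of_antisymm (e := fun i => D i - D (p - i)) ?_ ?_ ?_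
    · have ha := hD 1 (by omega)
      have hb := hD (p - 1) (by omega)
      rw [show p - (p - 1) = 1 by omega] at hb
      linarith
    · intro i hi hip
      simp only [show p - (p - i) = i by omega]
      ring
    · intro i hi hip
      have ha := h5 (i + 1) (by omega) (by omega)
      have hc := hD i (by omega)
      have hd := hD (i + 2) (by omega)
      simp only [Nat.add_sub_cancel, add_assoc, Nat.reduceAdd] at ha
      have hb := h4 (i + 1) (by omega) (by omega)
      simp only [Nat.add_sub_cancel, add_assoc, Nat.reduceAdd] at hb
      linarith
  refine ⟨?_, fun i hi hip => by linarith [key i hi (by omega)]⟩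
  have ha := h5 1 le_rfl (by omega)
  have hb := hD 0 (by omega)
  have hc := hD 2 (by omega)
  have hd := key 2 (by omega) (by omega)
  simp only [Nat.sub_self, Nat.sub_zero, Nat.reduceAdd] at ha hb
  linarith
end

section
/- Fix an integer p ≥ 3 and suppose the family of triples (R'_i, B'_i, D'_i), (R_i, B_i, D_i), (R_s, B_s, D_s) is a positive angle structure for the edge-equation system of τ_p. Then: (a) D_{i−1} − D'_{i−1} = D_{i+1} − D'_{i+1} for i = 2,…,p−2; (b) D_s − D'_0 = D_2 − D'_2; (c) D_{p−2} − D'_{p−2} = D_p − D_s; (d) D_{p−1} − D'_{p−1} = D_1 − D'_1; and (e) if p is odd, then all of the quantities D_1 − D'_1, …, D_{p−1} − D'_{p−1}, D_s − D'_0, and D_p − D_s are equal to each other. -/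
open Real

/-- A sequence that is 2-periodic on `[1, n]` agrees at odd indices with its value at `1`
and at positive even indices with its value at `2`. -/
theorem eq_of_two_step {α : Type*} (X : ℕ → α) (n : ℕ)
    (hX : ∀ j, 1 ≤ j → j + 2 ≤ n → X j = X (j + 2)) (m : ℕ) :
    (2 * m + 1 ≤ n → X (2 * m + 1) = X 1) ∧ (2 * m + 2 ≤ n → X (2 * m + 2) = X 2) := by
  induction m with
  | zero => simp
  | succ m ih =>
    exact ⟨fun h => (hX (2 * m + 1) (by omega) (by omega)).symm.trans (ih.1 (by omega)),
      fun h => (hX (2 * m + 2) (by omega) (by omega)).symm.trans (ih.2 (by omega))⟩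

/-- Relations among the differences of diagonal angles of a positive angle structure
on `τ_p`, and, when `p` is odd, the equality of all such differences. -/
theorem diagonal_difference_relations (p : ℕ) (hp : 3 ≤ p)
    (R' B' D' R B D : ℕ → ℝ) (Rs Bs Ds : ℝ)
    (h : IsPosAngleStructure p R' B' D' R B D Rs Bs Ds) :
    -- (a)
    (∀ i, 2 ≤ i → i ≤ p - 2 → D (i - 1) - D' (i - 1) = D (i + 1) - D' (i + 1)) ∧
    -- (b)
    (Ds - D' 0 = D 2 - D' 2) ∧
    -- (c)
    (D (p - 2) - D' (p - 2) = D p - Ds) ∧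
    -- (d)
    (D (p - 1) - D' (p - 1) = D 1 - D' 1) ∧
    -- (e)
    (Odd p →
      (∀ i, 1 ≤ i → i ≤ p - 1 → D i - D' i = D p - Ds) ∧ Ds - D' 0 = D p - Ds) := by
  obtain ⟨-, -, -, -, -, -, -, h2, h3, h4, h5, h6, h7⟩ := h
  have ha : ∀ i, 2 ≤ i → i ≤ p - 2 → D (i - 1) - D' (i - 1) = D (i + 1) - D' (i + 1) := by
    intro i hi hip
    linarith [h4 i hi hip, h5 i (by omega) (by omega)]
  have hb : Ds - D' 0 = D 2 - D' 2 := by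
    have := h5 1 le_rfl (by omega)
    norm_num at this
    linarith
  have hc : D (p - 2) - D' (p - 2) = D p - Ds := by
    have := h5 (p - 1) (by omega) le_rfl
    rw [show p - 1 - 1 = p - 2 by omega, show p - 1 + 1 = p by omega] at this
    linarith
  have hd : D (p - 1) - D' (p - 1) = D 1 - D' 1 := by linarith
  refine ⟨ha, hb, hc, hd, ?_⟩
  rintro ⟨k, rfl⟩
  have key := eq_of_two_step (fun i => D i - D' i) (2 * k) fun j hj hjk => by
    simpa using ha (j + 1) (by omega) (by omega)
  obtain ⟨l, rfl⟩ : ∃ l, k = l + 1 := ⟨k - 1, by omega⟩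
  have hodd := (key l).1 (by omega)
  have heven := (key l).2 (by omega)
  rw [show 2 * (l + 1) + 1 - 2 = 2 * l + 1 by omega] at hc
  rw [show 2 * (l + 1) + 1 - 1 = 2 * l + 2 by omega] at hd
  refine ⟨fun i hi hip => ?_, by linarith⟩
  obtain ⟨m, rfl | rfl⟩ : ∃ m, i = 2 * m + 1 ∨ i = 2 * m + 2 := ⟨(i - 1) / 2, by omega⟩
  · have := (key m).1 (by omega)
    linarith
  · have := (key m).2 (by omega)
    linarith
end

section
/- For every integer p ≥ 1, there do not exist integers p₀ and q₀ such that the element C²σ₁ᵖσ₂⁻¹ of B₃ is conjugate in B₃ to σ₁^{p₀}σ₂^{q₀}. -/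
/-- The single braid relation `σ₁σ₂σ₁ = σ₂σ₁σ₂` as a relator in the free group on two
generators. -/
def braidRels : Set (FreeGroup (Fin 2)) :=
  {FreeGroup.of 0 * FreeGroup.of 1 * FreeGroup.of 0 *
    (FreeGroup.of 1 * FreeGroup.of 0 * FreeGroup.of 1)⁻¹}

/-- The braid group on three strands, `B₃ = ⟨σ₁, σ₂ ∣ σ₁σ₂σ₁ = σ₂σ₁σ₂⟩`. -/
abbrev BraidGroup3 : Type := PresentedGroup braidRels

/-- The generator `σ₁` of `B₃`. -/
def sig1 : BraidGroup3 := PresentedGroup.of 0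

/-- The generator `σ₂` of `B₃`. -/
def sig2 : BraidGroup3 := PresentedGroup.of 1

/-- The central element `C = (σ₁σ₂)³` of `B₃`. -/
def Cfull : BraidGroup3 := (sig1 * sig2) ^ 3

open ModularGroup in
/-- The representation `B₃ → SL(2, ℤ)` sending `σ₁` and `σ₂` to elementary parabolic matrices. -/
def braidToSL : BraidGroup3 →* Matrix.SpecialLinearGroup (Fin 2) ℤ :=
  PresentedGroup.toGroup (f := ![T, S * T * S⁻¹]) (by
    rintro r rfl
    simp only [map_mul, map_inv, FreeGroup.lift_apply_of, Matrix.cons_val_zero, Matrix.cons_val_one]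
    decide)

/-- The exponent sum `B₃ → ℤ`. -/
def braidExponentSum : BraidGroup3 →* Multiplicative ℤ :=
  PresentedGroup.toGroup (f := fun _ => Multiplicative.ofAdd 1) (by
    rintro r rfl
    simp)

theorem braidToSL_sig1 : braidToSL sig1 = ModularGroup.T :=
  PresentedGroup.toGroup.of _

theorem braidToSL_sig2 :
    braidToSL sig2 = ModularGroup.S * ModularGroup.T * ModularGroup.S⁻¹ :=
  PresentedGroup.toGroup.of _

theorem braidExponentSum_sig1 : braidExponentSum sig1 = Multiplicative.ofAdd 1 :=
  PresentedGroup.toGroup.of _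

theorem braidExponentSum_sig2 : braidExponentSum sig2 = Multiplicative.ofAdd 1 :=
  PresentedGroup.toGroup.of _

theorem braidToSL_Cfull_sq : braidToSL (Cfull ^ 2) = 1 := by
  simp only [Cfull, map_pow, map_mul, braidToSL_sig1, braidToSL_sig2]
  decide

theorem trace_braidToSL_sig1_zpow_mul_sig2_zpow (m n : ℤ) :
    (braidToSL (sig1 ^ m * sig2 ^ n)).val.trace = 2 - m * n := by
  rw [map_mul, map_zpow, map_zpow, braidToSL_sig1, braidToSL_sig2, conj_zpow]
  simp only [Matrix.SpecialLinearGroup.coe_mul, ModularGroup.coe_T_zpow, ModularGroup.coe_S,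
    Matrix.SpecialLinearGroup.coe_inv, Matrix.adjugate_fin_two, Matrix.trace_fin_two,
    Matrix.mul_apply, Fin.sum_univ_two]
  simp
  ring

theorem trace_eq_of_isConj {g h : Matrix.SpecialLinearGroup (Fin 2) ℤ} (hgh : IsConj g h) :
    g.val.trace = h.val.trace := by
  obtain ⟨c, rfl⟩ := isConj_iff.1 hgh
  rw [Matrix.SpecialLinearGroup.coe_mul, Matrix.trace_mul_comm, ← Matrix.SpecialLinearGroup.coe_mul,
    ← mul_assoc, inv_mul_cancel, one_mul]

/-- For every integer `p ≥ 1`, the braid `C²σ₁ᵖσ₂⁻¹` is not conjugate in `B₃` to any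
braid of the form `σ₁^{p₀}σ₂^{q₀}` with `p₀, q₀ ∈ ℤ`. -/
theorem not_conj_to_sigma_powers (p : ℤ) (hp : 1 ≤ p) :
    ¬ ∃ p₀ q₀ : ℤ, IsConj (Cfull ^ 2 * sig1 ^ p * sig2⁻¹) (sig1 ^ p₀ * sig2 ^ q₀) := by
  rintro ⟨a, b, h⟩
  have htrace := trace_eq_of_isConj (braidToSL.map_isConj h)
  rw [mul_assoc, map_mul, braidToSL_Cfull_sq, one_mul, ← zpow_neg_one,
    trace_braidToSL_sig1_zpow_mul_sig2_zpow, trace_braidToSL_sig1_zpow_mul_sig2_zpow] at htrace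
  have hsum := congrArg Multiplicative.toAdd (isConj_iff_eq.1 (braidExponentSum.map_isConj h))
  simp [Cfull, braidExponentSum_sig1, braidExponentSum_sig2] at hsum
  have hab : a * b = -p := by linarith
  rcases lt_trichotomy a 0 with ha | rfl | ha
  · have hb : 0 < b := by nlinarith
    nlinarith
  · omega
  · have hb : b < 0 := by nlinarith
    nlinarith
end

section
/- For every integer p ≥ 1, the element C²σ₁ᵖσ₂⁻¹ of B₃ is conjugate in B₃ to σ₁³σ₂σ₁^{p+6}σ₂. -/
theorem sig_braid : sig1 * sig2 * sig1 = sig2 * sig1 * sig2 := by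
  have h := PresentedGroup.mk_eq_one_iff.2 (Subgroup.subset_normalClosure
    (show _ ∈ braidRels from rfl))
  simp only [map_mul, map_inv] at h
  exact mul_inv_eq_one.1 h

section

variable {G : Type*} [Group G] {a b : G}

/-- The square of the half twist `aba` is the full twist `(ab)³`. -/
theorem half_twist_sq (h : a * b * a = b * a * b) : (a * b * a) ^ 2 = (a * b) ^ 3 := by
  calc (a * b * a) ^ 2 = (a * b * a) * (a * b * a) := sq _
    _ = (a * b * a) * (b * a * b) := by rw [← h]
    _ = (a * b) ^ 3 := by simp only [pow_succ, pow_zero, one_mul, mul_assoc]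

theorem half_twist_semiconj_left (h : a * b * a = b * a * b) :
    SemiconjBy (a * b * a) a b := by
  change a * b * a * a = b * (a * b * a)
  calc a * b * a * a = b * a * b * a := by rw [h]
    _ = b * (a * b * a) := by simp only [mul_assoc]

theorem half_twist_semiconj_right (h : a * b * a = b * a * b) :
    SemiconjBy (a * b * a) b a := by
  change a * b * a * b = a * (a * b * a)
  calc a * b * a * b = a * (b * a * b) := by simp only [mul_assoc]
    _ = a * (a * b * a) := by rw [h]

theorem half_twist_sq_commute (h : a * b * a = b * a * b) :
    Commute ((a * b * a) ^ 2) a := by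
  rw [sq]
  exact (half_twist_semiconj_right h).mul_left (half_twist_semiconj_left h)

theorem isConj_full_twist_sq (h : a * b * a = b * a * b) (p : ℤ) :
    IsConj (((a * b) ^ 3) ^ 2 * a ^ p * b⁻¹) ((a * b * a) ^ 3 * a ^ (p + 2)) := by
  have hc := (half_twist_sq_commute h).pow_left 2
  rw [← half_twist_sq h]
  have hb : b⁻¹ = a * (a * b * a)⁻¹ * a := by group
  rw [hb]
  generalize a * b * a = d at *
  refine isConj_iff.2 ⟨d⁻¹ * a, ?_⟩
  calc d⁻¹ * a * ((d ^ 2) ^ 2 * a ^ p * (a * d⁻¹ * a)) * (d⁻¹ * a)⁻¹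
      = d⁻¹ * (a * (d ^ 2) ^ 2) * a ^ p * a := by group
    _ = d⁻¹ * ((d ^ 2) ^ 2 * a) * a ^ p * a := by rw [hc.eq]
    _ = d ^ 3 * a ^ (p + 2) := by group

theorem isConj_pretzel (h : a * b * a = b * a * b) (p : ℤ) :
    IsConj (a ^ 3 * b * a ^ (p + 6) * b) ((a * b * a) ^ 3 * a ^ (p + 2)) := by
  have hc := half_twist_sq_commute h
  have hs := (half_twist_semiconj_left h).eq
  have hb : b = a⁻¹ * (a * b * a) * a⁻¹ := by group
  generalize a * b * a = d at *
  subst hb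
  have key : a * d * a = d * a⁻¹ * d := by
    rw [mul_assoc, hs]
    group
  refine isConj_iff.2 ⟨a * d * a⁻¹, ?_⟩
  calc a * d * a⁻¹ * (a ^ 3 * (a⁻¹ * d * a⁻¹) * a ^ (p + 6) * (a⁻¹ * d * a⁻¹)) * (a * d * a⁻¹)⁻¹
      = (a * d * a) * d * a ^ (p + 3) * a⁻¹ * a := by group
    _ = (d * a⁻¹ * d) * d * a ^ (p + 3) * a⁻¹ * a := by rw [key]
    _ = d * a⁻¹ * (d ^ 2 * a) * a ^ (p + 2) := by rw [sq]; group
    _ = d * a⁻¹ * (a * d ^ 2) * a ^ (p + 2) := by rw [hc.eq]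
    _ = d ^ 3 * a ^ (p + 2) := by group

end

/-- For every integer `p ≥ 1`, the braid `C²σ₁ᵖσ₂⁻¹` is conjugate in `B₃` to
`σ₁³σ₂σ₁^{p+6}σ₂`. -/
theorem conj_to_pretzel_braid (p : ℤ) (hp : 1 ≤ p) :
    IsConj (Cfull ^ 2 * sig1 ^ p * sig2⁻¹)
      (sig1 ^ 3 * sig2 * sig1 ^ (p + 6) * sig2) := by
  exact (isConj_full_twist_sq sig_braid p).trans (isConj_pretzel sig_braid p).symm
end
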